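/- arXiv:1003.0544 — 3 statements merged into one kernel-verified Lean document; each statement's English description precedes it below -/
import Mathlib

section
/- Let (R, m) be a Cohen-Macaulay local ring and J an ideal of odd grade g ≥ 1, with ω_{R/J} = Ext^g_R(R/J, R). Then the signed partial sum P^{≤g}_{ω_{R/J}}(-1) = ∑_{i=0}^{g} (-1)^i β_i^R(ω_{R/J}) ≤ 0. In particular, if g = 1 then β_1^R(ω_{R/J}) ≥ β_0^R(ω_{R/J}). -/
open CategoryTheory IsLocalRing RingTheory.Sequence

noncomputable section

variable (R : Type) [CommRing R]

/-- `Tor_n^R(M, N)` as an object of `ModuleCat R`. -/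
def TorM (n : ℕ) (M N : ModuleCat R) : ModuleCat R :=
  ((Tor (ModuleCat R) n).obj M).obj N

/-- `Ext_R^n(M, N)` as an object of `ModuleCat R`. -/
def ExtM (n : ℕ) (M N : ModuleCat R) : ModuleCat R :=
  ((Ext R (ModuleCat R) n).obj (Opposite.op M)).obj N

/-- `b` is the `j`-th Betti number of `M`, i.e. `Tor_j(k, M) ≅ k^b`. -/
def HasBetti [IsLocalRing R] (M : ModuleCat R) (j b : ℕ) : Prop :=
  Nonempty (TorM R j (ModuleCat.of R (ResidueField R)) M ≅
    ModuleCat.of R (Fin b → ResidueField R))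

/-- `b` is the `j`-th Bass number of `M`, i.e. `Ext^j(k, M) ≅ k^b`. -/
def HasBass [IsLocalRing R] (M : ModuleCat R) (j b : ℕ) : Prop :=
  Nonempty (ExtM R j (ModuleCat.of R (ResidueField R)) M ≅
    ModuleCat.of R (Fin b → ResidueField R))

/-- Projective dimension at most `n`: all `Ext^m(M, -)` vanish for `m > n`. -/
def ProjDimLE (M : ModuleCat R) (n : ℕ) : Prop :=
  ∀ m > n, ∀ N : ModuleCat R, Limits.IsZero (ExtM R m M N)

def ProjDimEq (M : ModuleCat R) (n : ℕ) : Prop :=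
  ProjDimLE R M n ∧ ∀ m : ℕ, ProjDimLE R M m → n ≤ m

/-- The ideal `I` contains a regular sequence of length `g`. -/
def GradeGE (I : Ideal R) (g : ℕ) : Prop :=
  ∃ rs : List R, rs.length = g ∧ (∀ x ∈ rs, x ∈ I) ∧ IsRegular R rs

/-- `grade I = g`. -/
def GradeEq (I : Ideal R) (g : ℕ) : Prop :=
  GradeGE R I g ∧ ∀ rs : List R, (∀ x ∈ rs, x ∈ I) → IsRegular R rs → rs.length ≤ g

/-- The height of a prime ideal, as the Krull dimension of the localization. -/
def primeHt (p : Ideal R) [p.IsPrime] : WithBot (WithTop ℕ) :=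
  ringKrullDim (Localization.AtPrime p)

/-- The height of an ideal: the infimum of heights of minimal primes over it. -/
def idealHt (I : Ideal R) : WithBot (WithTop ℕ) :=
  sInf { h | ∃ p : PrimeSpectrum R, p.asIdeal ∈ I.minimalPrimes ∧
    ringKrullDim (Localization.AtPrime p.asIdeal) = h }

/-- The `p`-primary component of `I` (contraction of the extension to `R_p`). -/
def primaryComponent (I p : Ideal R) [p.IsPrime] : Ideal R :=
  (I.map (algebraMap R (Localization.AtPrime p))).comap
    (algebraMap R (Localization.AtPrime p))

/-- The unmixed part of `I`: intersection of the primary components at the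
minimal primes of minimal height. -/
def unmixedPart (I : Ideal R) : Ideal R :=
  ⨅ p : { p : PrimeSpectrum R // p.asIdeal ∈ I.minimalPrimes ∧
      ringKrullDim (Localization.AtPrime p.asIdeal) = idealHt R I },
    primaryComponent R I p.1.asIdeal

/-- The quotient `R ⧸ J` is a Cohen-Macaulay module over the local ring `R`. -/
def IsCMQuot [IsLocalRing R] (J : Ideal R) : Prop :=
  ∃ rs : List R, (∀ x ∈ rs, x ∈ maximalIdeal R) ∧ IsRegular (R ⧸ J) rs ∧
    (rs.length : WithBot (WithTop ℕ)) = ringKrullDim (R ⧸ J)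

/-- A Cohen-Macaulay local ring. -/
def IsCMLocalRing [IsLocalRing R] : Prop := IsCMQuot R ⊥

/-- A Gorenstein local ring: Cohen-Macaulay of type 1. -/
def IsGorensteinLocalRing [IsLocalRing R] : Prop :=
  IsCMLocalRing R ∧ ∃ d : ℕ, (d : WithBot (WithTop ℕ)) = ringKrullDim R ∧
    HasBass R (ModuleCat.of R R) d 1

/-- `M` has rank `r`: `M ⊗ Q` is free of rank `r` over the total quotient ring `Q`. -/
def HasRank (M : Type) [AddCommGroup M] [Module R M] (r : ℕ) : Prop :=
  Nonempty (LocalizedModule (nonZeroDivisors R) M ≃ₗ[Localization (nonZeroDivisors R)]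
    (Fin r → Localization (nonZeroDivisors R)))

end

noncomputable section

open TensorProduct in
/-- A finite module over a local ring has a free cover whose kernel lies in `𝔪 Rⁿ`. -/
theorem exists_minimal_cover {R : Type} [CommRing R] [IsLocalRing R] (N : Type) [AddCommGroup N]
    [Module R N] [Module.Finite R N] :
    ∃ (n : ℕ) (f : (Fin n → R) →ₗ[R] N), Function.Surjective f ∧
      ∀ v, f v = 0 → ∀ i, v i ∈ maximalIdeal R := by
  let w := Module.finBasis (ResidueField R) (ResidueField R ⊗[R] N)
  obtain ⟨v, hv⟩ := (TensorProduct.mk_surjective R N (ResidueField R)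
    Ideal.Quotient.mk_surjective).comp_left w
  refine ⟨_, Fintype.linearCombination R v, ?_, fun a ha i => ?_⟩
  · rw [← LinearMap.range_eq_top, Fintype.range_linearCombination]
    exact span_eq_top_of_tmul_eq_basis v w (congr_fun hv)
  · have h : ∑ i, residue R (a i) • w i = 0 := by
      have h1 := congrArg (TensorProduct.mk R (ResidueField R) N 1) ha
      simp only [Fintype.linearCombination_apply, map_sum, map_smul, map_zero] at h1
      rw [← h1]
      refine Finset.sum_congr rfl fun i _ => ?_
      rw [← congr_fun hv i]
      exact algebraMap_smul _ _ _
    exact (residue_eq_zero_iff _).1 (Fintype.linearIndependent_iff.1 w.linearIndependent _ h i)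

/-- The length of the localization of `M` at the prime `p`. -/
def localLength {R : Type} [CommRing R] (p : Ideal R) [p.IsPrime] (M : Type) [AddCommGroup M]
    [Module R M] : ℕ∞ :=
  Module.length (Localization.AtPrime p) (LocalizedModule p.primeCompl M)

section

variable {R : Type} [CommRing R] (p : Ideal R) [p.IsPrime]

theorem localLength_add {A B C : Type} [AddCommGroup A] [Module R A] [AddCommGroup B] [Module R B]
    [AddCommGroup C] [Module R C] (f : A →ₗ[R] B) (g : B →ₗ[R] C) (hf : Function.Injective f)
    (hg : Function.Surjective g) (h : Function.Exact f g) :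
    localLength p B = localLength p A + localLength p C :=
  Module.length_eq_add_of_exact
    (LocalizedModule.map p.primeCompl f) (LocalizedModule.map p.primeCompl g)
    (LocalizedModule.map_injective _ f hf) (LocalizedModule.map_surjective _ g hg)
    (LocalizedModule.map_exact _ f g h)

theorem localLength_pi (n : ℕ) :
    localLength p (Fin n → R) =
      n * Module.length (Localization.AtPrime p) (Localization.AtPrime p) := by
  have e : LocalizedModule p.primeCompl (Fin n → R) ≃ₗ[Localization.AtPrime p]
      (Fin n → Localization.AtPrime p) :=
    (IsLocalizedModule.iso p.primeCompl
      (LinearMap.pi fun i => (Algebra.linearMap R (Localization.AtPrime p)) ∘ₗ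
        (LinearMap.proj i))).extendScalarsOfIsLocalization p.primeCompl _
  rw [localLength, e.length_eq, Module.length_pi]
  simp

theorem localLength_eq_zero {M : Type} [AddCommGroup M] [Module R M] {x : R} (hx : x ∉ p)
    (h : ∀ m : M, x • m = 0) : localLength p M = 0 := by
  rw [localLength, Module.length_eq_zero_iff, LocalizedModule.subsingleton_iff]
  exact fun m => ⟨x, hx, h m⟩

theorem length_localization_ne_top [IsNoetherianRing R] (hp : p ∈ minimalPrimes R) :
    Module.length (Localization.AtPrime p) (Localization.AtPrime p) ≠ ⊤ := by
  have := Ring.KrullDimLE.of_isLocalization p hp (Localization.AtPrime p)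
  have := IsNoetherianRing.isArtinianRing_of_krullDimLE_zero (R := Localization.AtPrime p)
  exact Module.length_ne_top
end

section

variable {R : Type} [CommRing R]

theorem finite_homology [IsNoetherianRing R] (S : ShortComplex (ModuleCat.{0} R))
    [Module.Finite R S.X₂] : Module.Finite R S.homology := by
  have : Module.Finite R S.moduleCatLeftHomologyData.H :=
    inferInstanceAs (Module.Finite R (LinearMap.ker S.g.hom ⧸ LinearMap.range S.moduleCatToCycles))
  exact Module.Finite.equiv S.moduleCatHomologyIso.toLinearEquiv.symm

theorem smul_homology_eq_zero (S : ShortComplex (ModuleCat.{0} R)) (x : R)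
    (h : ∀ z, S.g z = 0 → ∃ w, S.f w = x • z) (a : S.homology) : x • a = 0 := by
  refine S.moduleCatHomologyIso.toLinearEquiv.injective ?_
  rw [map_smul, map_zero]
  generalize S.moduleCatHomologyIso.toLinearEquiv a = b
  obtain ⟨⟨z, hz⟩, rfl⟩ := Submodule.mkQ_surjective (LinearMap.range S.moduleCatToCycles) b
  obtain ⟨w, hw⟩ := h z hz
  refine (map_smul (Submodule.mkQ _) x _).symm.trans ((Submodule.Quotient.mk_eq_zero _).2 ?_)
  exact ⟨w, Subtype.ext hw⟩

theorem length_homology_of_zeros (S : ShortComplex (ModuleCat.{0} R)) (hf : S.f = 0)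
    (hg : S.g = 0) : Module.length R S.homology = Module.length R S.X₂ :=
  (ShortComplex.LeftHomologyData.ofZeros S hf hg).homologyIso.toLinearEquiv.length_eq

variable (N : ModuleCat.{0} R)

theorem finite_ext [IsNoetherianRing R] {M : ModuleCat.{0} R} (P : ProjectiveResolution M) (n : ℕ)
    [Module.Finite R (P.complex.X n)] [Module.Finite R N] :
    Module.Finite R (((Ext R (ModuleCat.{0} R) n).obj (Opposite.op M)).obj N) := by
  have : Module.Finite R (P.complex.X n ⟶ N) :=
    Module.Finite.equiv (ModuleCat.homLinearEquiv (S := R)).symm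
  have : Module.Finite R ((P.complex.linearYonedaObj R N).sc n).X₂ := this
  have : Module.Finite R ((P.complex.linearYonedaObj R N).homology n) :=
    finite_homology ((P.complex.linearYonedaObj R N).sc n)
  exact Module.Finite.equiv (P.isoExt (R := R) n N).toLinearEquiv.symm

theorem smul_ext_eq_zero (M : ModuleCat.{0} R) (n : ℕ) (x : R)
    (hx : ∀ m : M, x • m = 0)
    (a : ((Ext R (ModuleCat.{0} R) (n + 1)).obj (Opposite.op M)).obj N) : x • a = 0 := by
  let P := projectiveResolution M
  let H : Homotopy (x • 𝟙 P.complex) 0 := ProjectiveResolution.liftHomotopy 0 _ _ (by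
    rw [Linear.smul_comp, Category.id_comp, Functor.map_zero, Limits.comp_zero]
    refine (ChainComplex.toSingle₀Equiv _ _).injective (Subtype.ext ?_)
    change x • P.π.f 0 = 0
    ext m
    exact hx _) (by simp)
  suffices ∀ b : (P.complex.linearYonedaObj R N).homology (n + 1), x • b = 0 by
    refine (P.isoExt (R := R) (n + 1) N).toLinearEquiv.injective ?_
    rw [map_smul, map_zero, this]
  let K := P.complex.linearYonedaObj R N
  let I : (P.complex.linearYonedaObj R N).homology (n + 1) ≅ (K.sc' n (n + 1) (n + 2)).homology :=
    ShortComplex.homologyMapIso (K.isoSc' n (n + 1) (n + 2) (by simp) (by simp))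
  intro b
  refine I.toLinearEquiv.injective ?_
  rw [map_smul, map_zero]
  refine smul_homology_eq_zero (K.sc' n (n + 1) (n + 2)) x
    (fun (z : P.complex.X (n + 1) ⟶ N) hz => ?_) _
  refine ⟨H.hom n (n + 1) ≫ z, ?_⟩
  have hz : P.complex.d (n + 2) (n + 1) ≫ z = 0 := hz
  change P.complex.d (n + 1) n ≫ H.hom n (n + 1) ≫ z = x • z
  have e := H.comm (n + 1)
  rw [Homotopy.dNext_succ_chainComplex, Homotopy.prevD_chainComplex] at e
  have e' := congrArg (· ≫ z) e
  simp only [Preadditive.add_comp, Category.assoc, hz] at e'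
  simpa using e'.symm
end

section

variable {R : Type} [CommRing R] [IsLocalRing R]

/-- The rank of a minimal free cover. -/
def coverRank (N : ModuleCat.{0} R) [Module.Finite R N] : ℕ :=
  (exists_minimal_cover (R := R) N).choose

/-- A minimal free cover of a finite module over a local ring. -/
def cover (N : ModuleCat.{0} R) [Module.Finite R N] : (Fin (coverRank N) → R) →ₗ[R] N :=
  (exists_minimal_cover (R := R) N).choose_spec.choose

theorem cover_surjective (N : ModuleCat.{0} R) [Module.Finite R N] :
    Function.Surjective (cover N) :=
  (exists_minimal_cover (R := R) N).choose_spec.choose_spec.1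

theorem mem_maximalIdeal_of_cover_eq_zero (N : ModuleCat.{0} R) [Module.Finite R N]
    {v : Fin (coverRank N) → R} (hv : cover N v = 0) (i : Fin (coverRank N)) :
    v i ∈ maximalIdeal R :=
  (exists_minimal_cover (R := R) N).choose_spec.choose_spec.2 v hv i

theorem length_pi_residueField (n : ℕ) : Module.length R (Fin n → ResidueField R) = n := by
  have : IsSimpleModule R (ResidueField R) :=
    isSimpleModule_iff_isCoatom.2 (maximalIdeal.isMaximal R).out
  rw [Module.length_pi]
  simp

variable [IsNoetherianRing R]

/-- The iterated minimal syzygies of a finite module. -/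
def syzygy (M : ModuleCat.{0} R) [hM : Module.Finite R M] :
    ℕ → {N : ModuleCat.{0} R // Module.Finite R N}
  | 0 => ⟨M, hM⟩
  | n + 1 =>
    have := (syzygy M n).2
    ⟨ModuleCat.of R (LinearMap.ker (cover (syzygy M n).1)), inferInstance⟩

variable (M : ModuleCat.{0} R) [Module.Finite R M]

instance (n : ℕ) : Module.Finite R (syzygy M n).1 := (syzygy M n).2

/-- The ranks of the free modules in the minimal free resolution. -/
abbrev minRank (n : ℕ) : ℕ := coverRank (syzygy M n).1

/-- The inclusion of a syzygy in the preceding free module. -/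
def syzygyι (n : ℕ) : (syzygy M (n + 1)).1 →ₗ[R] (Fin (minRank M n) → R) :=
  (LinearMap.ker (cover (syzygy M n).1)).subtype

theorem syzygyι_injective (n : ℕ) : Function.Injective (syzygyι M n) :=
  Subtype.val_injective

theorem exact_syzygyι_cover (n : ℕ) :
    Function.Exact (syzygyι M n) (cover (syzygy M n).1) :=
  LinearMap.exact_subtype_ker_map _

/-- The differential of the minimal free resolution. -/
def minD (n : ℕ) : (Fin (minRank M (n + 1)) → R) →ₗ[R] (Fin (minRank M n) → R) :=
  syzygyι M n ∘ₗ cover (syzygy M (n + 1)).1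

theorem exact_minD_cover (n : ℕ) : Function.Exact (minD M n) (cover (syzygy M n).1) := by
  intro y
  rw [exact_syzygyι_cover M n y, minD, LinearMap.coe_comp,
    (cover_surjective (syzygy M (n + 1)).1).range_comp]

theorem exact_minD (n : ℕ) : Function.Exact (minD M (n + 1)) (minD M n) := by
  intro y
  rw [← exact_minD_cover M (n + 1) y]
  exact map_eq_zero_iff _ (syzygyι_injective M n)

theorem minD_apply_mem (n : ℕ) (v : Fin (minRank M (n + 1)) → R) (i : Fin (minRank M n)) :
    minD M n v i ∈ maximalIdeal R :=
  mem_maximalIdeal_of_cover_eq_zero _ ((exact_minD_cover M n).apply_apply_eq_zero v) i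

/-- The minimal free resolution of `M`, as a complex. -/
def minComplex : ChainComplex (ModuleCat.{0} R) ℕ :=
  ChainComplex.of (fun n => ModuleCat.of R (Fin (minRank M n) → R))
    (fun n => ModuleCat.ofHom (minD M n)) (fun n => by
      ext1
      exact (exact_minD M n).linearMap_comp_eq_zero)

theorem minComplex_d (n : ℕ) : (minComplex M).d (n + 1) n = ModuleCat.ofHom (minD M n) :=
  ChainComplex.of_d (fun n => ModuleCat.of R (Fin (minRank M n) → R))
    (fun n => ModuleCat.ofHom (minD M n)) n

/-- The augmentation of the minimal free resolution of `M`. -/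
def minAug : (minComplex M).X 0 ⟶ M :=
  ModuleCat.ofHom (cover (syzygy M 0).1)

theorem minComplex_d_minAug : (minComplex M).d 1 0 ≫ minAug M = 0 := by
  rw [minComplex_d]
  ext1
  exact (exact_minD_cover M 0).linearMap_comp_eq_zero

theorem exact_minAug : (ShortComplex.mk _ _ (minComplex_d_minAug M)).Exact := by
  refine (ShortComplex.ShortExact.moduleCat_exact_iff_function_exact _).2 ?_
  change Function.Exact ((minComplex M).d 1 0) (minAug M)
  rw [minComplex_d]
  exact exact_minD_cover M 0

instance : Epi (minAug M) :=
  (ModuleCat.epi_iff_surjective _).2 (cover_surjective (syzygy M 0).1)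

theorem minComplex_exactAt_succ (n : ℕ) : (minComplex M).ExactAt (n + 1) := by
  rw [HomologicalComplex.exactAt_iff' _ (n + 1 + 1) (n + 1) n (by simp) (by simp)]
  refine (ShortComplex.ShortExact.moduleCat_exact_iff_function_exact _).2 ?_
  change Function.Exact ((minComplex M).d (n + 2) (n + 1)) ((minComplex M).d (n + 1) n)
  rw [minComplex_d, minComplex_d]
  exact exact_minD M n

/-- The minimal free resolution of `M`. -/
def minResolution : ProjectiveResolution M where
  complex := minComplex M
  projective n :=
    ModuleCat.projective_of_free (M := ModuleCat.of R (Fin (minRank M n) → R)) (Pi.basisFun R _)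
  π := (ChainComplex.toSingle₀Equiv _ _).symm ⟨minAug M, minComplex_d_minAug M⟩
  quasiIso := ⟨fun n => by
    cases n with
    | zero =>
      rw [ChainComplex.quasiIsoAt₀_iff, ShortComplex.quasiIso_iff_of_zeros']
      · refine (ShortComplex.exact_and_epi_g_iff_of_iso ?_).2
          ⟨exact_minAug M, inferInstanceAs (Epi (minAug M))⟩
        exact ShortComplex.isoMk (Iso.refl _) (Iso.refl _) (Iso.refl _)
          ((Category.id_comp _).trans (Category.comp_id _).symm)
          ((Category.id_comp _).trans (Category.comp_id _).symm)
      all_goals rfl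
    | succ n =>
      rw [quasiIsoAt_iff_exactAt']
      · exact minComplex_exactAt_succ M n
      · apply ChainComplex.exactAt_succ_single_obj⟩

instance (n : ℕ) : Module.Finite R ((minResolution M).complex.X n) :=
  inferInstanceAs (Module.Finite R (Fin (minRank M n) → R))

open MonoidalCategory

theorem residueField_whiskerLeft_minComplex_d (i j : ℕ) :
    ModuleCat.of R (ResidueField R) ◁ (minComplex M).d i j = 0 := by
  by_cases h : j + 1 = i
  · subst h
    rw [minComplex_d]
    refine ModuleCat.hom_ext (TensorProduct.ext' fun a v => ?_)
    change a ⊗ₜ[R] (minD M j v) = 0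
    rw [pi_eq_sum_univ (minD M j v), TensorProduct.tmul_sum]
    refine Finset.sum_eq_zero fun i _ => ?_
    rw [← TensorProduct.smul_tmul]
    have : minD M j v i • a = 0 := by
      rw [Algebra.smul_def]
      change residue R _ * a = 0
      rw [(residue_eq_zero_iff _).2 (minD_apply_mem M j v i), zero_mul]
    rw [this, TensorProduct.zero_tmul]
  · rw [(minComplex M).shape i j h]
    simp

theorem length_tor_residueField (n : ℕ) :
    Module.length R (((Tor (ModuleCat.{0} R) n).obj (ModuleCat.of R (ResidueField R))).obj M) =
      minRank M n := by
  let F := (tensoringLeft (ModuleCat.{0} R)).obj (ModuleCat.of R (ResidueField R))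
  refine ((minResolution M).isoLeftDerivedObj F n).toLinearEquiv.length_eq.trans ?_
  refine (length_homology_of_zeros _ (residueField_whiskerLeft_minComplex_d M _ _)
    (residueField_whiskerLeft_minComplex_d M _ _)).trans ?_
  change Module.length R (TensorProduct R (ResidueField R) (Fin (minRank M n) → R)) = _
  rw [(TensorProduct.piScalarRight R R (ResidueField R) (Fin (minRank M n))).length_eq,
    length_pi_residueField]

theorem localLength_syzygy_succ (p : Ideal R) [p.IsPrime] (n : ℕ) :
    localLength p (syzygy M (n + 1)).1 + localLength p (syzygy M n).1 =
      minRank M n * Module.length (Localization.AtPrime p) (Localization.AtPrime p) := by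
  rw [← localLength_add p _ _ (syzygyι_injective M n) (cover_surjective _)
    (exact_syzygyι_cover M n), localLength_pi]

/-- If `M` vanishes at `p`, the localized length of a syzygy is the alternating sum of
the ranks in the minimal resolution. -/
theorem exists_localLength_syzygy (p : Ideal R) [p.IsPrime]
    (hM : localLength p M = 0) {l : ℕ}
    (hl : Module.length (Localization.AtPrime p) (Localization.AtPrime p) = l) (n : ℕ) :
    ∃ a : ℕ, localLength p (syzygy M n).1 = a ∧
      (a : ℤ) = (-1) ^ (n + 1) * (∑ i ∈ Finset.range n, (-1) ^ i * (minRank M i : ℤ)) * l := by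
  induction n with
  | zero => exact ⟨0, hM, by simp⟩
  | succ n ih =>
    obtain ⟨a, ha, ha'⟩ := ih
    have h := localLength_syzygy_succ M p n
    rw [ha, hl] at h
    obtain ⟨b, hb⟩ := ENat.ne_top_iff_exists.1
      (show localLength p (syzygy M (n + 1)).1 ≠ ⊤ by
        intro h'
        rw [h', top_add] at h
        exact absurd h.symm (by exact_mod_cast ENat.natCast_ne_top _))
    refine ⟨b, hb.symm, ?_⟩
    rw [← hb] at h
    have h : (b : ℤ) + a = minRank M n * l := by exact_mod_cast h
    have h2 : ((-1 : ℤ) ^ n) * (-1) ^ n = 1 := by rw [← mul_pow]; simp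
    rw [Finset.sum_range_succ]
    rw [pow_succ] at ha'
    linear_combination h - ha' - (minRank M n * l : ℤ) * h2

theorem sum_minRank_nonpos (p : Ideal R) [p.IsPrime] (hp : p ∈ minimalPrimes R)
    (hM : localLength p M = 0) {n : ℕ} (hn : Odd n) :
    ∑ i ∈ Finset.range (n + 1), (-1) ^ i * (minRank M i : ℤ) ≤ 0 := by
  obtain ⟨l, hl⟩ := ENat.ne_top_iff_exists.1 (length_localization_ne_top p hp)
  obtain ⟨a, -, ha⟩ := exists_localLength_syzygy M p hM hl.symm (n + 1)
  have hpos : 0 < l := by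
    have := Module.length_pos (R := Localization.AtPrime p) (M := Localization.AtPrime p)
    rw [← hl] at this
    exact_mod_cast this
  rw [Odd.neg_one_pow (by simpa [Nat.odd_add_one] using hn)] at ha
  by_contra! h
  have : 0 < (∑ i ∈ Finset.range (n + 1), (-1) ^ i * (minRank M i : ℤ)) * l := by positivity
  have := Int.natCast_nonneg a
  linarith
end

end

theorem stmt16 (R : Type) [CommRing R] [IsNoetherianRing R] [IsLocalRing R]
    (hCM : IsCMLocalRing R)
    (J : Ideal R) (g : ℕ) (hg1 : 1 ≤ g) (hodd : Odd g)
    (hgrade : GradeEq R J g)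
    (bω : ℕ → ℕ)
    (hbω : ∀ i, HasBetti R
      (ExtM R g (ModuleCat.of R (R ⧸ J)) (ModuleCat.of R R)) i (bω i)) :
    (∑ i ∈ Finset.range (g+1), (-1)^i * (bω i : ℤ) ≤ 0) ∧
      (g = 1 → bω 0 ≤ bω 1) := by
  have hodd' : ∑ i ∈ Finset.range (g + 1), (-1) ^ i * (bω i : ℤ) ≤ 0 := by
    let E := ExtM R g (ModuleCat.of R (R ⧸ J)) (ModuleCat.of R R)
    obtain ⟨rs, hlen, hJ, hreg⟩ := hgrade.1
    obtain ⟨x, xs, rfl⟩ := List.exists_cons_of_length_pos (hlen ▸ hg1)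
    have hxJ : x ∈ J := hJ x (by simp)
    have hx : IsSMulRegular R x := ((isRegular_cons_iff R x xs).1 hreg).1
    have hx' : x ∈ nonZeroDivisors R :=
      mem_nonZeroDivisors_iff_right.2 fun y hy => hx.right_eq_zero_of_smul (by
        rw [smul_eq_mul, mul_comm, hy])
    obtain ⟨p, hp, -⟩ := Ideal.exists_minimalPrimes_le (bot_le : ⊥ ≤ maximalIdeal R)
    have := hp.1.1
    have hxp : x ∉ p := fun h => notMem_nonZeroDivisors_of_mem_mem_minimalPrimes h hp hx'
    have hfin : Module.Finite R E := finite_ext _ (minResolution (ModuleCat.of R (R ⧸ J))) g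
    have hkill : ∀ a : E, x • a = 0 := by
      obtain ⟨n, rfl⟩ := Nat.exists_eq_add_of_le' hg1
      refine smul_ext_eq_zero _ _ n x fun m => ?_
      obtain ⟨r, rfl⟩ := Ideal.Quotient.mk_surjective m
      exact Ideal.Quotient.eq_zero_iff_mem.2 (J.mul_mem_right r hxJ)
    have hb : ∀ i, bω i = minRank E i := fun i => by
      have h := (hbω i).some.toLinearEquiv.length_eq
      have h' := (length_tor_residueField E i).symm.trans
        (h.trans (length_pi_residueField (R := R) (bω i)))
      exact_mod_cast h'.symm
    simp only [hb]
    exact sum_minRank_nonpos E p hp (localLength_eq_zero p hxp hkill) hodd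
  refine ⟨hodd', ?_⟩
  rintro rfl
  simp [Finset.sum_range_succ] at hodd'
  omega
end

section
/- Let (R, m) be a Cohen-Macaulay local ring and J an ideal of even grade g ≥ 2, with ω_{R/J} = Ext^g_R(R/J, R). Then P^{≤g}_{ω_{R/J}}(-1) = ∑_{i=0}^{g} (-1)^i β_i^R(ω_{R/J}) ≥ 0. -/
open CategoryTheory IsLocalRing RingTheory.Sequence

open TensorProduct in
/-- Every finite module over a local ring is covered by a finite free module whose relations have
all their coefficients in the maximal ideal. -/
theorem exists_minimal_free_cover {R M : Type*} [CommRing R] [IsLocalRing R] [AddCommGroup M]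
    [Module R M] [Module.Finite R M] :
    ∃ (n : ℕ) (f : (Fin n → R) →ₗ[R] M), Function.Surjective f ∧
      ∀ x, f x = 0 → ∀ i, x i ∈ maximalIdeal R := by
  let b := Module.finBasis (ResidueField R) (ResidueField R ⊗[R] M)
  have hs := TensorProduct.mk_surjective R M (ResidueField R) residue_surjective
  choose v hv using fun i => hs (b i)
  refine ⟨_, Fintype.linearCombination R v, ?_, ?_⟩
  · rw [← LinearMap.range_eq_top, Fintype.range_linearCombination]
    exact span_eq_top_of_tmul_eq_basis v b hv
  · intro x hx i
    have h : ∑ j, residue R (x j) • b j = 0 := by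
      have h1 := congrArg (TensorProduct.mk R (ResidueField R) M 1) hx
      rw [Fintype.linearCombination_apply, map_sum, map_zero] at h1
      rw [← h1]
      refine Finset.sum_congr rfl fun j _ => ?_
      rw [map_smul, hv]
      exact algebraMap_smul (ResidueField R) (x j) (b j)
    rw [← residue_eq_zero_iff]
    exact Fintype.linearIndependent_iff.1 b.linearIndependent _ h i

theorem exists_minimal_cover_ker {R M : Type*} [CommRing R] [IsLocalRing R]
    [IsNoetherianRing R] [AddCommGroup M] [Module R M] {n : ℕ} (f : (Fin n → R) →ₗ[R] M) :
    ∃ (m : ℕ) (g : (Fin m → R) →ₗ[R] (Fin n → R)), LinearMap.range g = LinearMap.ker f ∧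
      ∀ x, g x = 0 → ∀ i, x i ∈ maximalIdeal R := by
  obtain ⟨m, g, hg, hm⟩ := exists_minimal_free_cover (R := R) (M := LinearMap.ker f)
  refine ⟨m, (LinearMap.ker f).subtype ∘ₗ g, ?_, fun x hx => hm x (by simpa using hx)⟩
  rw [LinearMap.range_comp, LinearMap.range_eq_top.2 hg, Submodule.map_top, Submodule.range_subtype]

/-- A linear map between finite free modules in coordinates. -/
structure FreeMap (R : Type*) [CommRing R] where
  source : ℕ
  target : ℕ
  map : (Fin source → R) →ₗ[R] (Fin target → R)

/-- The data of a minimal free resolution of a finite module, in coordinates. -/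
structure MinimalFreeResolution (R M : Type*) [CommRing R] [IsLocalRing R] [AddCommGroup M]
    [Module R M] where
  rank : ℕ → ℕ
  d (i : ℕ) : (Fin (rank (i + 1)) → R) →ₗ[R] (Fin (rank i) → R)
  aug : (Fin (rank 0) → R) →ₗ[R] M
  aug_surjective : Function.Surjective aug
  range_d_zero : LinearMap.range (d 0) = LinearMap.ker aug
  range_d_succ (i : ℕ) : LinearMap.range (d (i + 1)) = LinearMap.ker (d i)
  d_mem (i : ℕ) (x) (j) : d i x j ∈ maximalIdeal R

theorem exists_minimalFreeResolution (R M : Type*) [CommRing R] [IsLocalRing R]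
    [IsNoetherianRing R] [AddCommGroup M] [Module R M] [Module.Finite R M] :
    Nonempty (MinimalFreeResolution R M) := by
  obtain ⟨n, f, hf, hmin⟩ := exists_minimal_free_cover (R := R) (M := M)
  obtain ⟨a, d₀, h₀, hmin₀⟩ := exists_minimal_cover_ker f
  choose m g hg hg' using fun e : FreeMap R => exists_minimal_cover_ker e.map
  let s : ℕ → FreeMap R :=
    fun i => Nat.rec ⟨a, n, d₀⟩ (fun _ e => ⟨m e, e.source, g e⟩) i
  have hs (i : ℕ) : ∀ x, (s i).map x = 0 → ∀ j, x j ∈ maximalIdeal R := by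
    cases i with
    | zero => exact hmin₀
    | succ i => exact hg' _
  exact ⟨{
    rank := fun i => (s i).target
    d := fun i => (s i).map
    aug := f
    aug_surjective := hf
    range_d_zero := h₀
    range_d_succ := fun i => hg (s i)
    d_mem := fun i => by
      cases i with
      | zero =>
        intro x
        refine hmin _ ?_
        have : d₀ x ∈ LinearMap.ker f := h₀ ▸ LinearMap.mem_range_self d₀ x
        exact this
      | succ i =>
        intro x
        refine hs i _ ?_
        have : g (s i) x ∈ LinearMap.ker (s i).map := hg (s i) ▸ LinearMap.mem_range_self _ x
        exact this }⟩

namespace MinimalFreeResolution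

variable {R : Type} [CommRing R] [IsLocalRing R] {M : Type} [AddCommGroup M] [Module R M]
  (F : MinimalFreeResolution R M)

/-- The chain complex underlying a minimal free resolution. -/
noncomputable def complex : ChainComplex (ModuleCat R) ℕ :=
  ChainComplex.of (fun i => ModuleCat.of R (Fin (F.rank i) → R)) (fun i => ModuleCat.ofHom (F.d i))
    fun i => by
      ext1
      exact LinearMap.range_le_ker_iff.1 (F.range_d_succ i).le

theorem complex_d (i : ℕ) : F.complex.d (i + 1) i = ModuleCat.ofHom (F.d i) :=
  ChainComplex.of_d (fun i => ModuleCat.of R (Fin (F.rank i) → R))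
    (fun i => ModuleCat.ofHom (F.d i)) i

theorem complex_exactAt_succ (i : ℕ) : F.complex.ExactAt (i + 1) := by
  rw [HomologicalComplex.exactAt_iff' _ (i + 1 + 1) (i + 1) i (by simp) (by simp),
    ShortComplex.moduleCat_exact_iff_range_eq_ker]
  dsimp only [HomologicalComplex.sc', HomologicalComplex.shortComplexFunctor']
  rw [complex_d, complex_d]
  exact F.range_d_succ i

/-- A minimal free resolution as a projective resolution. -/
noncomputable def toProjectiveResolution : ProjectiveResolution (ModuleCat.of R M) where
  complex := F.complex
  projective i := ModuleCat.projective_of_free (Pi.basisFun R (Fin (F.rank i)))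
  π := (ChainComplex.toSingle₀Equiv _ _).symm ⟨ModuleCat.ofHom F.aug, by
    rw [complex_d]
    ext1
    exact LinearMap.range_le_ker_iff.1 F.range_d_zero.le⟩
  quasiIso := ⟨fun i => by
    cases i with
    | zero =>
      rw [ChainComplex.quasiIsoAt₀_iff, ShortComplex.quasiIso_iff_of_zeros']
      · refine ⟨(ShortComplex.moduleCat_exact_iff_range_eq_ker _).2 ?_,
          (ModuleCat.epi_iff_surjective _).2 ?_⟩
        · change LinearMap.range (F.complex.d 1 0).hom = LinearMap.ker F.aug
          rw [complex_d]
          exact F.range_d_zero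
        · exact F.aug_surjective
      all_goals rfl
    | succ i =>
      rw [quasiIsoAt_iff_exactAt']
      · exact F.complex_exactAt_succ i
      · exact ChainComplex.exactAt_succ_single_obj _ _⟩

open MonoidalCategory in
theorem tensor_d_eq_zero (i : ℕ) :
    ModuleCat.of R (ResidueField R) ◁ F.complex.d (i + 1) i = 0 := by
  rw [complex_d]
  ext1
  refine TensorProduct.ext' fun a x => ?_
  change a ⊗ₜ[R] F.d i x = 0
  rw [← (TensorProduct.piScalarRight R R (ResidueField R) (Fin (F.rank i))).map_eq_zero_iff,
    TensorProduct.piScalarRight_apply,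
    TensorProduct.piScalarRightHom_tmul]
  ext j
  rw [Algebra.smul_def, ResidueField.algebraMap_eq, (residue_eq_zero_iff _).2 (F.d_mem i x j),
    zero_mul, Pi.zero_apply]

/-- The Betti numbers of a module are the ranks in a minimal free resolution. -/
theorem eq_rank_of_hasBetti {i b : ℕ} (h : HasBetti R (ModuleCat.of R M) i b) :
    b = F.rank i := by
  obtain ⟨e⟩ := h
  let T := (MonoidalCategory.tensoringLeft (ModuleCat R)).obj (ModuleCat.of R (ResidueField R))
  let C := (T.mapHomologicalComplex (ComplexShape.down ℕ)).obj F.complex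
  have hd (j k : ℕ) : C.d j k = 0 := by
    by_cases hjk : k + 1 = j
    · subst hjk
      exact F.tensor_d_eq_zero k
    · exact C.shape j k hjk
  have e₁ : TorM R i (ModuleCat.of R (ResidueField R)) (ModuleCat.of R M) ≅ C.homology i :=
    F.toProjectiveResolution.isoLeftDerivedObj T i
  have e₂ : C.homology i ≅ C.X i :=
    (ShortComplex.HomologyData.ofZeros (C.sc i) (hd _ _) (hd _ _)).left.homologyIso
  have e₃ : ModuleCat.of R (Fin b → ResidueField R) ≅ C.X i := e.symm ≪≫ e₁ ≪≫ e₂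
  have e₄ : (Fin b → ResidueField R) ≃ₗ[R] (Fin (F.rank i) → ResidueField R) :=
    e₃.toLinearEquiv.trans
      (TensorProduct.piScalarRight R R (ResidueField R) (Fin (F.rank i)))
  simpa using (e₄.extendScalarsOfSurjective (S := ResidueField R) residue_surjective).finrank_eq

end MinimalFreeResolution

theorem finite_extM {R : Type} [CommRing R] [IsLocalRing R] [IsNoetherianRing R]
    (M N : ModuleCat R) [Module.Finite R M] [Module.Finite R N] (n : ℕ) :
    Module.Finite R (ExtM R n M N) := by
  obtain ⟨F⟩ := exists_minimalFreeResolution R M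
  let C := F.toProjectiveResolution.complex.linearYonedaObj R N
  have hX : Module.Finite R (C.X n) :=
    Module.Finite.equiv (ModuleCat.homLinearEquiv (S := R)
      (M := ModuleCat.of R (Fin (F.rank n) → R)) (N := N)).symm
  have hZ : Module.Finite R (C.cycles n) :=
    Module.Finite.of_injective (C.iCycles n).hom ((ModuleCat.mono_iff_injective _).1 inferInstance)
  have hH : Module.Finite R (C.homology n) :=
    Module.Finite.of_surjective (C.homologyπ n).hom
      ((ModuleCat.epi_iff_surjective _).1 inferInstance)
  exact Module.Finite.equiv (F.toProjectiveResolution.isoExt n N).toLinearEquiv.symm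

section LocalizedLength

variable {R : Type*} [CommRing R] (p : Ideal R) [p.IsPrime]

/-- The length over `R_p` of the localization of a module at a prime `p`. -/
noncomputable def localizedLength (M : Type*) [AddCommGroup M] [Module R M] : ℕ∞ :=
  Module.length (Localization.AtPrime p) (LocalizedModule p.primeCompl M)

theorem localizedLength_eq_add {N M P : Type*} [AddCommGroup N] [Module R N] [AddCommGroup M]
    [Module R M] [AddCommGroup P] [Module R P] (f : N →ₗ[R] M) (g : M →ₗ[R] P)
    (hf : Function.Injective f) (hg : Function.Surjective g) (h : Function.Exact f g) :
    localizedLength p M = localizedLength p N + localizedLength p P :=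
  Module.length_eq_add_of_exact
    (IsLocalizedModule.mapExtendScalars p.primeCompl
      (LocalizedModule.mkLinearMap p.primeCompl N) (LocalizedModule.mkLinearMap p.primeCompl M)
      (Localization.AtPrime p) f)
    (IsLocalizedModule.mapExtendScalars p.primeCompl
      (LocalizedModule.mkLinearMap p.primeCompl M) (LocalizedModule.mkLinearMap p.primeCompl P)
      (Localization.AtPrime p) g)
    (IsLocalizedModule.map_injective _ _ _ _ hf)
    (IsLocalizedModule.map_surjective _ _ _ _ hg)
    (IsLocalizedModule.map_exact _ _ _ _ _ _ h)

theorem localizedLength_eq_ker_add_range {M N : Type*} [AddCommGroup M] [Module R M]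
    [AddCommGroup N] [Module R N] (f : M →ₗ[R] N) :
    localizedLength p M =
      localizedLength p (LinearMap.ker f) + localizedLength p (LinearMap.range f) :=
  localizedLength_eq_add p (LinearMap.ker f).subtype f.rangeRestrict Subtype.val_injective
    f.surjective_rangeRestrict fun x => by simp [Subtype.ext_iff]

theorem localizedLength_free (n : ℕ) :
    localizedLength p (Fin n → R) =
      n * Module.length (Localization.AtPrime p) (Localization.AtPrime p) := by
  have := (algebraMap R (Localization.AtPrime p)).domain_nontrivial
  have := Module.free_of_isLocalizedModule (Rₛ := Localization.AtPrime p) p.primeCompl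
    (LocalizedModule.mkLinearMap p.primeCompl (Fin n → R))
  rw [localizedLength, Module.length_of_free_of_finite,
    Module.finrank_of_isLocalizedModule_of_free (Localization.AtPrime p) p.primeCompl
      (LocalizedModule.mkLinearMap p.primeCompl (Fin n → R)), Module.finrank_fin_fun]

theorem isArtinianRing_localization_of_mem_minimalPrimes [IsNoetherianRing R]
    (hp : p ∈ minimalPrimes R) : IsArtinianRing (Localization.AtPrime p) := by
  rw [isArtinianRing_iff_isNoetherianRing_krullDimLE_zero]
  refine ⟨inferInstance, ?_⟩
  rw [Ring.krullDimLE_iff,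
    IsLocalization.AtPrime.ringKrullDim_eq_height p, Ideal.height_eq_zero_iff.2 hp]
  rfl

theorem mul_length_eq_ker_add_range {n ℓ : ℕ} {N : Type*} [AddCommGroup N] [Module R N]
    (hℓ : (ℓ : ℕ∞) = Module.length (Localization.AtPrime p) (Localization.AtPrime p))
    (f : (Fin n → R) →ₗ[R] N) :
    n * ℓ = (localizedLength p (LinearMap.ker f)).toNat +
      (localizedLength p (LinearMap.range f)).toNat := by
  have h : ((n * ℓ : ℕ) : ℕ∞) =
      localizedLength p (LinearMap.ker f) + localizedLength p (LinearMap.range f) := by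
    rw [← localizedLength_eq_ker_add_range, localizedLength_free, ← hℓ, Nat.cast_mul]
  have hne := h ▸ ENat.natCast_ne_top (n * ℓ)
  rw [Ne, ENat.add_eq_top, not_or] at hne
  rw [← ENat.toNat_add hne.1 hne.2, ← h, ENat.toNat_natCast]

end LocalizedLength

/-- The truncated alternating sum of the ranks in a minimal free resolution is nonnegative when
the truncation degree is even. -/
theorem MinimalFreeResolution.alternating_sum_nonneg {R M : Type*} [CommRing R] [IsLocalRing R]
    [IsNoetherianRing R] [AddCommGroup M] [Module R M] (F : MinimalFreeResolution R M) {n : ℕ}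
    (hn : Even n) : 0 ≤ ∑ i ∈ Finset.range (n + 1), (-1) ^ i * (F.rank i : ℤ) := by
  obtain ⟨p, hp⟩ := Ideal.nonempty_minimalPrimes (bot_ne_top (α := Ideal R))
  have := hp.isPrime
  have := isArtinianRing_localization_of_mem_minimalPrimes p hp
  obtain ⟨ℓ, hℓ⟩ := ENat.ne_top_iff_exists.1
    (Module.length_ne_top (R := Localization.AtPrime p) (M := Localization.AtPrime p))
  have hpos : 0 < ℓ := by
    have := Module.length_pos (R := Localization.AtPrime p) (M := Localization.AtPrime p)
    rw [← hℓ] at this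
    exact_mod_cast this
  let z (i : ℕ) : ℕ := (localizedLength p (LinearMap.range (F.d i))).toNat
  let a : ℕ := (localizedLength p (LinearMap.range F.aug)).toNat
  have h₀ : F.rank 0 * ℓ = z 0 + a := by
    have h := mul_length_eq_ker_add_range p hℓ F.aug
    rwa [← F.range_d_zero] at h
  have h₁ (i : ℕ) : F.rank (i + 1) * ℓ = z (i + 1) + z i := by
    have h := mul_length_eq_ker_add_range p hℓ (F.d i)
    rwa [← F.range_d_succ] at h
  have key (m : ℕ) : (∑ i ∈ Finset.range (m + 1), (-1) ^ i * (F.rank i : ℤ)) * ℓ =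
      a + (-1) ^ m * z m := by
    induction m with
    | zero => simp; exact_mod_cast h₀.trans (add_comm _ _)
    | succ m ih =>
      have h : (F.rank (m + 1) : ℤ) * ℓ = z (m + 1) + z m := mod_cast h₁ m
      rw [Finset.sum_range_succ, add_mul, ih, mul_assoc, h]
      ring
  refine nonneg_of_mul_nonneg_left (b := (ℓ : ℤ)) ?_ (mod_cast hpos)
  rw [key, hn.neg_one_pow]
  positivity

theorem stmt17 (R : Type) [CommRing R] [IsNoetherianRing R] [IsLocalRing R]
    (hCM : IsCMLocalRing R)
    (J : Ideal R) (g : ℕ) (hg2 : 2 ≤ g) (heven : Even g)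
    (hgrade : GradeEq R J g)
    (bω : ℕ → ℕ)
    (hbω : ∀ i, HasBetti R
      (ExtM R g (ModuleCat.of R (R ⧸ J)) (ModuleCat.of R R)) i (bω i)) :
    0 ≤ ∑ i ∈ Finset.range (g+1), (-1)^i * (bω i : ℤ) := by
  have := finite_extM (ModuleCat.of R (R ⧸ J)) (ModuleCat.of R R) g
  obtain ⟨F⟩ := exists_minimalFreeResolution R
    (ExtM R g (ModuleCat.of R (R ⧸ J)) (ModuleCat.of R R))
  simp only [fun i => F.eq_rank_of_hasBetti (hbω i)]
  exact F.alternating_sum_nonneg heven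
end

section
/- Let (R, m, k) be a Noetherian local ring, I an ideal with minimal free presentation 0 → Z → R^{β_0} → I → 0, and a ⊆ I an ideal generated by s elements with J = a : I satisfying grade(J) ≥ s. If β_1^R(I) - β_0^R(I) = -1 (so the presentation is 0 → R^{β_0-1} → R^{β_0} → I → 0), then J equals the ideal of β_0 × β_0 minors of a (β_0 + s - 1) × β_0 matrix ψ arising from the mapping cone of the inclusion a ⊆ I, i.e. J = I_{β_0}(ψ). -/
open CategoryTheory IsLocalRing RingTheory.Sequence

/-- A form of the acyclicity lemma: if every member of a sequence of length `g`, weakly regular on the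
terms of a cochain complex starting with zero, has a power killing the cohomology, then the first
`g` cohomology modules vanish. -/
theorem exact_of_isWeaklyRegular_of_pow_smul {R : Type*} [CommRing R] (rs : List R) :
    ∀ (A : ℕ → Type*) [∀ k, AddCommGroup (A k)] [∀ k, Module R (A k)]
      (d : ∀ k, A k →ₗ[R] A (k + 1)) [Subsingleton (A 0)],
      (∀ k a, d (k + 1) (d k a) = 0) → (∀ k, IsWeaklyRegular (A k) rs) →
      (∀ x ∈ rs, ∃ N : ℕ, ∀ k (a : A (k + 1)), d (k + 1) a = 0 → ∃ b, d k b = x ^ N • a) →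
      ∀ k < rs.length, ∀ a : A (k + 1), d (k + 1) a = 0 → ∃ b, d k b = a := by
  induction rs with
  | nil => simp
  | cons x rs ih =>
    intro A _ _ d _ hd hreg hkill
    have hx k : IsSMulRegular (A k) x := ((isWeaklyRegular_cons_iff _ _ _).1 (hreg k)).1
    have key := ih (fun k => QuotSMulTop x (A k)) (fun k => QuotSMulTop.map x (d k)) ?_
      (fun k => ((isWeaklyRegular_cons_iff _ _ _).1 (hreg k)).2) ?_
    · have cancel : ∀ k < (x :: rs).length, ∀ a : A (k + 1), d (k + 1) a = 0 →
          (∃ b, d k b = x • a) → ∃ b, d k b = a := by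
        rintro (_ | k) hk a ha ⟨b, hb⟩
        · refine ⟨0, hx _ ?_⟩
          simp only [← hb, map_zero, smul_zero, Subsingleton.elim b 0]
        · obtain ⟨c, hc⟩ := key k (by simpa using hk) (Submodule.Quotient.mk b) (by
            change Submodule.Quotient.mk (d (k + 1) b) = _
            rw [Submodule.Quotient.mk_eq_zero, hb]
            exact Submodule.smul_mem_pointwise_smul _ _ _ trivial)
          obtain ⟨c, rfl⟩ := Submodule.Quotient.mk_surjective _ c
          have hc : (Submodule.Quotient.mk (d k c) : QuotSMulTop x (A (k + 1))) =
            Submodule.Quotient.mk b := hc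
          rw [eq_comm, Submodule.Quotient.eq] at hc
          obtain ⟨e, -, he⟩ := hc
          have he : x • e = b - d k c := he
          refine ⟨e, hx _ ?_⟩
          simp only [← map_smul, he, ← hb, map_sub, hd, sub_zero]
      intro k hk a ha
      obtain ⟨N, hN⟩ := hkill x (by simp)
      have := hN k a ha
      clear hN
      induction N generalizing a with
      | zero => simpa using this
      | succ N ihN =>
        refine cancel k hk a ha (ihN (x • a) (by simp [ha]) ?_)
        simpa [pow_succ, mul_smul] using this
    · intro k a
      obtain ⟨a, rfl⟩ := Submodule.Quotient.mk_surjective _ a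
      change Submodule.Quotient.mk (d (k + 1) (d k a)) = _
      simp [hd]
    · intro y hy
      obtain ⟨N, hN⟩ := hkill y (by simp [hy])
      refine ⟨N + N, fun k a ha => ?_⟩
      obtain ⟨a, rfl⟩ := Submodule.Quotient.mk_surjective _ a
      have ha : (Submodule.Quotient.mk (d (k + 1) a) : QuotSMulTop x (A (k + 1 + 1))) = 0 := ha
      rw [Submodule.Quotient.mk_eq_zero] at ha
      obtain ⟨c, -, hc⟩ := ha
      have hc : x • c = d (k + 1) a := hc
      obtain ⟨b, hb⟩ := hN (k + 1) c (hx _ (by simp only [← map_smul, hc, hd, smul_zero]))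
      obtain ⟨b', hb'⟩ := hN k (y ^ N • a - x • b) (by
        rw [map_sub, map_smul, map_smul, ← hc, hb, smul_comm, sub_self])
      refine ⟨Submodule.Quotient.mk b', ?_⟩
      change Submodule.Quotient.mk (d k b') = _
      rw [hb', ← Submodule.Quotient.mk_smul, Submodule.Quotient.eq, pow_add, mul_smul, smul_sub,
        sub_sub_cancel_left, smul_comm, ← smul_neg]
      exact Submodule.smul_mem_pointwise_smul _ _ _ trivial

/-- Multiplication by `r` is homotopic to zero on an exact complex of projective modules as soon as
it is trivial at the end of the complex. -/
theorem exists_homotopy {R : Type*} [CommRing R] (A : ℕ → Type*) [∀ k, AddCommGroup (A k)]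
    [∀ k, Module R (A k)] [∀ k, Module.Projective R (A k)]
    (d : ∀ k, A k →ₗ[R] A (k + 1)) (hd : ∀ k a, d (k + 1) (d k a) = 0) (s : ℕ)
    (hexact : ∀ k < s, ∀ a : A (k + 1), d (k + 1) a = 0 → ∃ b, d k b = a) (r : R)
    (htop : ∀ a : A (s + 1), ∃ b, d s b = r • a) (i : ℕ) (hi : i ≤ s) :
    ∃ h : A (i + 1) →ₗ[R] A i, ∀ a, d i (h (d i a)) = r • d i a := by
  have lift (k : ℕ) (g : A (k + 1) →ₗ[R] A (k + 1)) (hg : ∀ a, ∃ b, d k b = g a) :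
      ∃ h : A (k + 1) →ₗ[R] A k, ∀ a, d k (h a) = g a := by
    obtain ⟨h, hh⟩ := Module.projective_lifting_property (d k).rangeRestrict
      (g.codRestrict (LinearMap.range (d k)) hg) (LinearMap.surjective_rangeRestrict _)
    exact ⟨h, fun a => congrArg Subtype.val (LinearMap.congr_fun hh a)⟩
  induction hi using Nat.decreasingInduction with
  | self =>
    obtain ⟨h, hh⟩ := lift s (r • LinearMap.id) htop
    exact ⟨h, fun a => hh _⟩
  | of_succ i hi ih =>
    obtain ⟨h, hh⟩ := ih
    obtain ⟨h', hh'⟩ := lift i (r • LinearMap.id - h ∘ₗ d (i + 1)) (fun a =>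
      hexact i hi _ (by simp [hh]))
    exact ⟨h', fun a => by simp [hh', hd]⟩

theorem isWeaklyRegular_of_flat {R M : Type*} [CommRing R] [AddCommGroup M] [Module R M]
    [Module.Flat R M] {rs : List R} (h : IsWeaklyRegular R rs) : IsWeaklyRegular M rs :=
  ((TensorProduct.rid R M).isWeaklyRegular_congr rs).1 (h.isWeaklyRegular_lTensor)

namespace KoszulStrand

section

variable {R V σ : Type*} [CommRing R] [AddCommGroup V] [Module R V] [DecidableEq σ]

/-- Multiplication by the variable `i` on families of coefficients indexed by exponents. -/
def mulVar (i : σ) : ((σ → ℕ) → V) →ₗ[R] ((σ → ℕ) → V) where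
  toFun ω α := if α i = 0 then 0 else ω (α - Pi.single i 1)
  map_add' ω η := by ext α; by_cases h : α i = 0 <;> simp [h]
  map_smul' r ω := by ext α; by_cases h : α i = 0 <;> simp [h]

/-- Division by the variable `i`, discarding the terms free of `i`. -/
def divVar (i : σ) : ((σ → ℕ) → V) →ₗ[R] ((σ → ℕ) → V) where
  toFun ω α := ω (α + Pi.single i 1)
  map_add' _ _ := rfl
  map_smul' _ _ := rfl

/-- The projection onto the terms free of the variable `i`. -/
def freeVar (i : σ) : ((σ → ℕ) → V) →ₗ[R] ((σ → ℕ) → V) where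
  toFun ω α := if α i = 0 then ω α else 0
  map_add' ω η := by ext α; by_cases h : α i = 0 <;> simp [h]
  map_smul' r ω := by ext α; by_cases h : α i = 0 <;> simp [h]

variable (R) in
theorem divVar_mulVar_self (i : σ) (ω : (σ → ℕ) → V) :
    divVar (R := R) i (mulVar (R := R) i ω) = ω := by
  ext α; simp [divVar, mulVar]

variable (R) in
theorem mulVar_divVar_self (i : σ) (ω : (σ → ℕ) → V) :
    mulVar (R := R) i (divVar (R := R) i ω) = ω - freeVar (R := R) i ω := by
  ext α
  by_cases h : α i = 0
  · simp [divVar, mulVar, freeVar, h]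
  · have : α - Pi.single i 1 + Pi.single i 1 = α := by
      ext j
      rcases eq_or_ne j i with rfl | hj
      · simp; omega
      · simp [hj]
    simp [divVar, mulVar, freeVar, h, this]

variable (R) in
theorem divVar_mulVar_of_ne {i j : σ} (hij : i ≠ j) (ω : (σ → ℕ) → V) :
    divVar (R := R) i (mulVar (R := R) j ω) = mulVar (R := R) j (divVar (R := R) i ω) := by
  ext α
  have : α + Pi.single i 1 - Pi.single j 1 = α - Pi.single j 1 + Pi.single i 1 := by
    ext l
    rcases eq_or_ne l i with rfl | hi
    · simp [hij]
    · simp [hi]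
  simp [divVar, mulVar, hij.symm, this]

variable (R) in
theorem mulVar_comm (i j : σ) (ω : (σ → ℕ) → V) :
    mulVar (R := R) i (mulVar (R := R) j ω) = mulVar (R := R) j (mulVar (R := R) i ω) := by
  rcases eq_or_ne i j with rfl | hij
  · rfl
  ext α
  simp only [mulVar, LinearMap.coe_mk, AddHom.coe_mk, Pi.sub_apply, Pi.single_eq_of_ne hij,
    Pi.single_eq_of_ne hij.symm, tsub_zero, tsub_right_comm (a := α) (b := Pi.single i 1)]
  split_ifs <;> rfl

omit [DecidableEq σ] in
theorem freeVar_comm (i j : σ) (ω : (σ → ℕ) → V) :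
    freeVar (R := R) i (freeVar (R := R) j ω) = freeVar (R := R) j (freeVar (R := R) i ω) := by
  ext α
  simp only [freeVar, LinearMap.coe_mk, AddHom.coe_mk]
  split_ifs <;> rfl

omit [DecidableEq σ] in
theorem freeVar_freeVar (i : σ) (ω : (σ → ℕ) → V) :
    freeVar (R := R) i (freeVar (R := R) i ω) = freeVar (R := R) i ω := by
  ext α
  simp only [freeVar, LinearMap.coe_mk, AddHom.coe_mk]
  split_ifs <;> rfl

variable (F : V →ₗ[R] V)

theorem compLeft_mulVar (i : σ) (ω : (σ → ℕ) → V) :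
    F.compLeft (σ → ℕ) (mulVar (R := R) i ω) = mulVar (R := R) i (F.compLeft (σ → ℕ) ω) := by
  ext α
  by_cases h : α i = 0 <;> simp [mulVar, h]

theorem compLeft_divVar (i : σ) (ω : (σ → ℕ) → V) :
    F.compLeft (σ → ℕ) (divVar (R := R) i ω) = divVar (R := R) i (F.compLeft (σ → ℕ) ω) := rfl

omit [DecidableEq σ] in
theorem compLeft_freeVar (i : σ) (ω : (σ → ℕ) → V) :
    F.compLeft (σ → ℕ) (freeVar (R := R) i ω) = freeVar (R := R) i (F.compLeft (σ → ℕ) ω) := by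
  ext α
  by_cases h : α i = 0 <;> simp [freeVar, h]

variable [Fintype σ]

/-- The Koszul-type differential `∑ i, X i * E i`. -/
def diff (E : σ → V →ₗ[R] V) : ((σ → ℕ) → V) →ₗ[R] ((σ → ℕ) → V) :=
  ∑ i, mulVar i ∘ₗ (E i).compLeft (σ → ℕ)

/-- The families with coefficients in `gr p` and concentrated in polynomial degree `k`. -/
def homog (gr : ℕ → Submodule R V) (σ : Type*) [Fintype σ] (p k : ℕ) :
    Submodule R ((σ → ℕ) → V) where
  carrier := {ω | ∀ α, ω α ∈ gr p ∧ (∑ i, α i ≠ k → ω α = 0)}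
  add_mem' h h' α := ⟨add_mem (h α).1 (h' α).1, fun hα => by
    simp [(h α).2 hα, (h' α).2 hα]⟩
  zero_mem' α := ⟨zero_mem _, fun _ => rfl⟩
  smul_mem' r ω h α := ⟨Submodule.smul_mem _ _ (h α).1, fun hα => by simp [(h α).2 hα]⟩

variable {gr : ℕ → Submodule R V} {p k : ℕ} {ω : (σ → ℕ) → V}

theorem mulVar_mem (i : σ) (h : ω ∈ homog gr σ p k) :
    mulVar (R := R) i ω ∈ homog gr σ p (k + 1) := by
  intro α
  by_cases hα : α i = 0
  · simp [mulVar, hα]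
  · refine ⟨by simpa [mulVar, hα] using (h _).1, fun hs => ?_⟩
    simp only [mulVar, LinearMap.coe_mk, AddHom.coe_mk, if_neg hα]
    refine (h _).2 fun h' => hs ?_
    have : α = (α - Pi.single i 1) + Pi.single i 1 := by
      ext j
      rcases eq_or_ne j i with rfl | hj
      · simp; omega
      · simp [hj]
    rw [this]
    simp only [Pi.add_apply, Finset.sum_add_distrib, h', Finset.sum_pi_single', Finset.mem_univ,
      if_true]

theorem divVar_mem (i : σ) (h : ω ∈ homog gr σ p (k + 1)) :
    divVar (R := R) i ω ∈ homog gr σ p k := by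
  refine fun α => ⟨(h _).1, fun hs => (h _).2 fun h' => hs ?_⟩
  simpa [Finset.sum_add_distrib] using h'

omit [DecidableEq σ] in
theorem freeVar_mem (i : σ) (h : ω ∈ homog gr σ p k) :
    freeVar (R := R) i ω ∈ homog gr σ p k := by
  intro α
  by_cases hα : α i = 0
  · simpa [freeVar, hα] using h α
  · simp [freeVar, hα]

omit [DecidableEq σ] in
theorem compLeft_mem {F : V →ₗ[R] V} {q : ℕ} (hF : ∀ u ∈ gr p, F u ∈ gr q)
    (h : ω ∈ homog gr σ p k) : F.compLeft (σ → ℕ) ω ∈ homog gr σ q k :=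
  fun α => ⟨hF _ (h α).1, fun hs => by simp [(h α).2 hs]⟩

variable {E : σ → V →ₗ[R] V}

theorem diff_apply (ω : (σ → ℕ) → V) :
    diff E ω = ∑ i, mulVar (R := R) i ((E i).compLeft (σ → ℕ) ω) := by
  simp [diff]

theorem diff_mem (hE : ∀ i p, ∀ u ∈ gr p, E i u ∈ gr (p + 1)) (h : ω ∈ homog gr σ p k) :
    diff E ω ∈ homog gr σ (p + 1) (k + 1) := by
  rw [diff_apply]
  exact sum_mem fun i _ => mulVar_mem i (compLeft_mem (hE i p) h)

theorem diff_diff (hE0 : ∀ i u, E i (E i u) = 0) (hE1 : ∀ i j u, E i (E j u) = - E j (E i u))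
    (ω : (σ → ℕ) → V) : diff E (diff E ω) = 0 := by
  simp only [diff_apply, map_sum, compLeft_mulVar]
  rw [← Finset.sum_product']
  refine Finset.sum_involution (fun a _ => a.swap) ?_ ?_ (by simp) (by simp)
  · rintro ⟨i, j⟩ -
    have : (E i).compLeft (σ → ℕ) ((E j).compLeft (σ → ℕ) ω) =
        - (E j).compLeft (σ → ℕ) ((E i).compLeft (σ → ℕ) ω) := by
      ext α; simp [hE1 i j]
    simp only [Prod.swap]
    rw [this, mulVar_comm R i j]
    simp
  · rintro ⟨i, j⟩ - h h'
    simp only [Prod.swap, Prod.mk.injEq] at h'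
    obtain rfl := h'.1
    refine h ?_
    have : (E j).compLeft (σ → ℕ) ((E j).compLeft (σ → ℕ) ω) = 0 := by
      ext α; simp [hE0]
    simp [this]

variable {C : σ → V →ₗ[R] V} {x : R}

theorem diff_homotopy (hCE : ∀ i j u, C i (E j u) + E j (C i u) = if i = j then x • u else 0)
    (i : σ) (ω : (σ → ℕ) → V) :
    diff E ((C i).compLeft (σ → ℕ) (divVar (R := R) i ω)) +
      (C i).compLeft (σ → ℕ) (divVar (R := R) i (diff E ω)) =
    x • ω - (E i).compLeft (σ → ℕ) ((C i).compLeft (σ → ℕ) (freeVar (R := R) i ω)) := by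
  have h1 (η : (σ → ℕ) → V) (j : σ) : (C i).compLeft (σ → ℕ) ((E j).compLeft (σ → ℕ) η) =
      (if i = j then x • η else 0) - (E j).compLeft (σ → ℕ) ((C i).compLeft (σ → ℕ) η) := by
    rw [eq_sub_iff_add_eq]
    ext α
    by_cases h : i = j <;> simp [hCE, h]
  have h2 : divVar (R := R) i (diff E ω) =
      diff E (divVar (R := R) i ω) + (E i).compLeft (σ → ℕ) (freeVar (R := R) i ω) := by
    rw [diff_apply, diff_apply, map_sum, ← Finset.add_sum_erase _ _ (Finset.mem_univ i),
      ← Finset.add_sum_erase _ _ (Finset.mem_univ i), divVar_mulVar_self, compLeft_divVar,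
      mulVar_divVar_self, ← compLeft_freeVar, add_right_comm, sub_add_cancel]
    congr 1
    refine Finset.sum_congr rfl fun j hj => ?_
    rw [divVar_mulVar_of_ne R (Finset.ne_of_mem_erase hj).symm, compLeft_divVar]
  have h3 (η : (σ → ℕ) → V) : (C i).compLeft (σ → ℕ) (diff E η) =
      x • mulVar (R := R) i η - diff E ((C i).compLeft (σ → ℕ) η) := by
    simp only [diff_apply, map_sum, compLeft_mulVar, h1, map_sub, Finset.sum_sub_distrib]
    congr 1
    rw [Finset.sum_eq_single i (by simp +contextual [eq_comm]) (by simp)]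
    simp
  rw [h2, map_add, h3, h1, mulVar_divVar_self, if_pos rfl, smul_sub]
  abel

omit [DecidableEq σ] in
theorem homog_eq_zero_of_freeVar (hk : k ≠ 0) (h : ω ∈ homog gr σ p k)
    (hω : ∀ i, freeVar (R := R) i ω = ω) : ω = 0 := by
  ext α
  by_cases hα : ∀ i, α i = 0
  · exact (h α).2 (by simpa [hα] using hk.symm)
  · push Not at hα
    obtain ⟨i, hi⟩ := hα
    rw [← hω i]
    simp [freeVar, hi]

theorem pow_smul_mem_range_diff
    (hE : ∀ i p, ∀ u ∈ gr p, E i u ∈ gr (p + 1))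
    (hE0 : ∀ i u, E i (E i u) = 0) (hE1 : ∀ i j u, E i (E j u) = - E j (E i u))
    (hC : ∀ i p, ∀ u ∈ gr (p + 1), C i u ∈ gr p)
    (hCE : ∀ i j u, C i (E j u) + E j (C i u) = if i = j then x • u else 0)
    (h : ω ∈ homog gr σ (p + 1) (k + 1)) (hω : diff E ω = 0) :
    ∃ η ∈ homog gr σ p k, diff E η = x ^ Fintype.card σ • ω := by
  suffices H : ∀ S : Finset σ, ∃ η ∈ homog gr σ p k, ∃ θ ∈ homog gr σ (p + 1) (k + 1),
      diff E η = x ^ S.card • ω - θ ∧ diff E θ = 0 ∧ ∀ i ∈ S, freeVar (R := R) i θ = θ by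
    obtain ⟨η, hη, θ, hθ, h1, -, h2⟩ := H Finset.univ
    refine ⟨η, hη, ?_⟩
    rw [h1, homog_eq_zero_of_freeVar k.succ_ne_zero hθ fun i => h2 i (Finset.mem_univ i),
      sub_zero, Finset.card_univ]
  intro S
  induction S using Finset.induction_on with
  | empty => exact ⟨0, zero_mem _, ω, h, by simp, hω, by simp⟩
  | insert i S hi ih =>
    obtain ⟨η, hη, θ, hθ, h1, h2, h3⟩ := ih
    have key := diff_homotopy hCE i θ
    rw [h2, map_zero, map_zero, add_zero] at key
    refine ⟨x • η + (C i).compLeft (σ → ℕ) (divVar (R := R) i θ),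
      add_mem (Submodule.smul_mem _ _ hη) (compLeft_mem (hC i p) (divVar_mem i hθ)),
      (E i).compLeft (σ → ℕ) ((C i).compLeft (σ → ℕ) (freeVar (R := R) i θ)),
      compLeft_mem (hE i p) (compLeft_mem (hC i p) (freeVar_mem i hθ)), ?_, ?_, ?_⟩
    · rw [map_add, map_smul, h1, key, Finset.card_insert_of_notMem hi, pow_succ', mul_smul,
        smul_sub]
      abel
    · rw [eq_sub_iff_add_eq, ← eq_sub_iff_add_eq'] at key
      rw [key, map_sub, map_smul, h2, diff_diff hE0 hE1, smul_zero, sub_zero]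
    · intro j hj
      rw [← compLeft_freeVar, ← compLeft_freeVar, freeVar_comm]
      rcases Finset.mem_insert.1 hj with rfl | hj
      · rw [freeVar_freeVar]
      · rw [h3 j hj]

theorem smul_mem_range_diff_of_top
    (hE : ∀ i p, ∀ u ∈ gr p, E i u ∈ gr (p + 1))
    (hC : ∀ i p, ∀ u ∈ gr (p + 1), C i u ∈ gr p)
    (hCE : ∀ i j u, C i (E j u) + E j (C i u) = if i = j then x • u else 0)
    (htop : gr (p + 2) = ⊥) (h : ω ∈ homog gr σ (p + 1) (k + 1)) :
    ∃ η ∈ homog gr σ p k, diff E η = x • ω := by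
  suffices H : ∀ S : Finset σ, ∃ η ∈ homog gr σ p k, ∃ θ ∈ homog gr σ (p + 1) (k + 1),
      diff E η = x • ω - x • θ ∧ ∀ i ∈ S, freeVar (R := R) i θ = θ by
    obtain ⟨η, hη, θ, hθ, h1, h2⟩ := H Finset.univ
    refine ⟨η, hη, ?_⟩
    rw [h1, homog_eq_zero_of_freeVar k.succ_ne_zero hθ fun i => h2 i (Finset.mem_univ i),
      smul_zero, sub_zero]
  intro S
  induction S using Finset.induction_on with
  | empty => exact ⟨0, zero_mem _, ω, h, by simp, by simp⟩
  | insert i S hi ih =>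
    obtain ⟨η, hη, θ, hθ, h1, h2⟩ := ih
    have hθ' : θ - freeVar (R := R) i θ ∈ homog gr σ (p + 1) (k + 1) :=
      sub_mem hθ (freeVar_mem i hθ)
    have hzero : diff E (θ - freeVar (R := R) i θ) = 0 := by
      ext α
      have := (diff_mem hE hθ' α).1
      rwa [htop, Submodule.mem_bot] at this
    have key := diff_homotopy hCE i (θ - freeVar (R := R) i θ)
    rw [hzero, map_zero, map_zero, add_zero, map_sub (freeVar i), freeVar_freeVar, sub_self,
      map_zero, map_zero, sub_zero] at key
    refine ⟨η + (C i).compLeft (σ → ℕ) (divVar (R := R) i (θ - freeVar (R := R) i θ)),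
      add_mem hη (compLeft_mem (hC i p) (divVar_mem i hθ')), freeVar (R := R) i θ,
      freeVar_mem i hθ, ?_, ?_⟩
    · rw [map_add, h1, key, smul_sub]
      abel
    · intro j hj
      rcases Finset.mem_insert.1 hj with rfl | hj
      · rw [freeVar_freeVar]
      · rw [freeVar_comm, h2 j hj]

omit [DecidableEq σ] in
theorem free_homog (hgr : Module.Free R (gr p)) : Module.Free R (homog gr σ p k) := by
  have : Finite {α : σ → ℕ // ∑ i, α i = k} := by
    refine Set.Finite.subset (Set.Finite.pi' fun _ : σ => Set.finite_Iic k) fun α hα i => ?_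
    simp only [Set.mem_Iic]
    rw [← show ∑ i, α i = k from hα]
    exact Finset.single_le_sum (fun _ _ => Nat.zero_le _) (Finset.mem_univ i)
  classical
  let e : ({α : σ → ℕ // ∑ i, α i = k} → gr p) ≃ₗ[R] homog gr σ p k :=
    { toFun := fun f => ⟨fun α => if h : ∑ i, α i = k then f ⟨α, h⟩ else 0, fun α => by
        by_cases h : ∑ i, α i = k <;> simp [h]⟩
      map_add' := fun f g => by
        ext α
        by_cases h : ∑ i, α i = k <;> simp [h]
      map_smul' := fun r f => by
        ext α
        by_cases h : ∑ i, α i = k <;> simp [h]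
      invFun := fun ω α => ⟨ω.1 α, (ω.2 α).1⟩
      left_inv := fun f => by ext ⟨α, rfl⟩; simp
      right_inv := fun ω => by
        ext α
        by_cases h : ∑ i, α i = k
        · simp [h]
        · simp [h, (ω.2 α).2 h] }
  exact Module.Free.of_equiv e

end

end KoszulStrand

namespace ExteriorAlgebra

open CliffordAlgebra

section

variable {R M : Type*} [CommRing R] [AddCommGroup M] [Module R M]

theorem ι_mul_mem_exteriorPower (m : M) (p : ℕ) (u : ExteriorAlgebra R M) (hu : u ∈ ⋀[R]^p M) :
    ExteriorAlgebra.ι R m * u ∈ ⋀[R]^(p + 1) M := by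
  rw [ExteriorAlgebra.exteriorPower, pow_succ']
  exact Submodule.mul_mem_mul (LinearMap.mem_range_self _ m) hu

theorem contractLeft_mem_exteriorPower (β : Module.Dual R M) (p : ℕ) (u : ExteriorAlgebra R M)
    (hu : u ∈ ⋀[R]^(p + 1) M) :
    contractLeft (Q := (0 : QuadraticForm R M)) β u ∈ ⋀[R]^p M := by
  induction p generalizing u with
  | zero =>
    rw [zero_add, ExteriorAlgebra.exteriorPower, pow_one] at hu
    obtain ⟨m, rfl⟩ := hu
    rw [ExteriorAlgebra.exteriorPower, pow_zero]
    exact (contractLeft_ι (Q := (0 : QuadraticForm R M)) β m).symm ▸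
      Submodule.algebraMap_mem _
  | succ p ih =>
    rw [ExteriorAlgebra.exteriorPower, pow_succ'] at hu
    induction hu using Submodule.mul_induction_on' with
    | mem_mul_mem a ha b hb =>
      obtain ⟨m, rfl⟩ := ha
      exact (contractLeft_ι_mul (Q := (0 : QuadraticForm R M)) β m b).symm ▸
        sub_mem (Submodule.smul_mem _ _ hb) (ι_mul_mem_exteriorPower m p _ (ih b hb))
    | add a _ b _ ha hb => simpa using add_mem ha hb

variable {σ : Type*} {v : σ → M}

theorem contractLeft_prod_mul {β : Module.Dual R M} {l : List σ} (h : ∀ j ∈ l, β (v j) = 0)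
    (y : ExteriorAlgebra R M) :
    contractLeft (Q := (0 : QuadraticForm R M)) β
        ((l.map fun j => ExteriorAlgebra.ι R (v j)).prod * y) =
      (-1 : R) ^ l.length • ((l.map fun j => ExteriorAlgebra.ι R (v j)).prod *
        contractLeft (Q := (0 : QuadraticForm R M)) β y) := by
  induction l with
  | nil => simp
  | cons i l ih =>
    rw [List.map_cons, List.prod_cons, mul_assoc]
    refine (contractLeft_ι_mul (Q := (0 : QuadraticForm R M)) _ _ _).trans ?_
    rw [ih fun j hj => h j (by simp [hj]), h i (by simp), zero_smul, zero_sub, List.length_cons,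
      pow_succ, mul_neg_one, neg_smul, mul_smul_comm, mul_assoc]

variable [DecidableEq σ] {β : σ → Module.Dual R M} {x : R}

theorem exists_pow_smul_eq_prod_mul (hβ : ∀ i j, β i (v j) = if i = j then x else 0)
    {l : List σ} (hl : l.Nodup) {q : ℕ} {u : ExteriorAlgebra R M} (hu : u ∈ ⋀[R]^(q + l.length) M)
    (h : ∀ i, ExteriorAlgebra.ι R (v i) * u = 0) :
    ∃ w ∈ ⋀[R]^q M, x ^ l.length • u = (l.map fun j => ExteriorAlgebra.ι R (v j)).prod * w := by
  induction l generalizing q with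
  | nil => exact ⟨u, hu, by simp⟩
  | cons i l ih =>
    obtain ⟨hi, hl⟩ := List.nodup_cons.1 hl
    obtain ⟨w, hw, hwu⟩ := ih hl (q := q + 1) (by
      rwa [List.length_cons, add_comm l.length, ← add_assoc] at hu)
    have hx : x • u = ExteriorAlgebra.ι R (v i) *
        contractLeft (Q := (0 : QuadraticForm R M)) (β i) u := by
      have := contractLeft_ι_mul (Q := (0 : QuadraticForm R M)) (β i) (v i) u
      rw [hβ, if_pos rfl] at this
      have h0 := congrArg (contractLeft (Q := (0 : QuadraticForm R M)) (β i)) (h i)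
      rw [map_zero] at h0
      exact sub_eq_zero.1 (this.symm.trans h0)
    refine ⟨(-1 : R) ^ l.length • contractLeft (Q := (0 : QuadraticForm R M)) (β i) w,
      Submodule.smul_mem _ _ (contractLeft_mem_exteriorPower _ _ _ hw), ?_⟩
    rw [List.length_cons, pow_succ, mul_smul, hx, ← mul_smul_comm, ← map_smul, hwu,
      contractLeft_prod_mul, List.map_cons, List.prod_cons, mul_smul_comm, mul_assoc,
      mul_smul_comm, mul_smul_comm]
    intro j hj
    rw [hβ, if_neg]
    rintro rfl
    exact hi hj

theorem pow_mul_eq_zero_of_smul_prod (hβ : ∀ i j, β i (v j) = if i = j then x else 0)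
    {l : List σ} (hl : l.Nodup) {c : R}
    (h : c • (l.map fun j => ExteriorAlgebra.ι R (v j)).prod = 0) : x ^ l.length * c = 0 := by
  induction l generalizing c with
  | nil =>
    rw [List.map_nil, List.prod_nil, ← Algebra.algebraMap_eq_smul_one] at h
    simpa using (ExteriorAlgebra.algebraMap_leftInverse M).injective (h.trans (map_zero _).symm)
  | cons i l ih =>
    obtain ⟨hi, hl⟩ := List.nodup_cons.1 hl
    have h0 := congrArg (contractLeft (Q := (0 : QuadraticForm R M)) (β i)) h
    have h1 := contractLeft_prod_mul (R := R) (v := v) (β := β i) (l := l) (fun j hj => by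
      rw [hβ, if_neg]
      rintro rfl
      exact hi hj) 1
    rw [contractLeft_one, mul_zero, smul_zero, mul_one] at h1
    rw [map_smul, map_zero, List.map_cons, List.prod_cons] at h0
    have h2 := contractLeft_ι_mul (Q := (0 : QuadraticForm R M)) (β i) (v i)
      (l.map fun j => ExteriorAlgebra.ι R (v j)).prod
    rw [h1, hβ, if_pos rfl, mul_zero, sub_zero] at h2
    rw [List.length_cons, pow_succ, mul_assoc]
    refine ih hl ?_
    rw [mul_comm, mul_smul]
    exact (congrArg (c • ·) h2).symm.trans h0

theorem exteriorPower_eq_bot [Nontrivial R] [Module.Free R M] [Module.Finite R M] {p : ℕ}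
    (hp : Module.finrank R M < p) : ⋀[R]^p M = ⊥ := by
  rw [← Submodule.subsingleton_iff_eq_bot, ← Module.finrank_eq_zero_iff_of_free (R := R),
    exteriorPower.finrank_eq, Nat.choose_eq_zero_of_lt hp]

end

end ExteriorAlgebra

theorem exteriorPower.apply_ιMulti_mem_span_minors {R ι : Type*} [CommRing R] [Finite ι] {n : ℕ}
    (v : Fin n → ι → R) (f : ⋀[R]^n (ι → R) →ₗ[R] R) :
    f (exteriorPower.ιMulti R n v) ∈ Ideal.span {x : R | ∃ c : Fin n → ι,
      Function.Injective c ∧ x = Matrix.det (Matrix.of fun i k => v i (c k))} := by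
  classical
  have := Fintype.ofFinite ι
  let : LinearOrder ι := LinearOrder.lift' (Fintype.equivFin ι) (Fintype.equivFin ι).injective
  rw [← ((Pi.basisFun R ι).exteriorPower n).sum_repr (exteriorPower.ιMulti R n v), map_sum]
  refine Ideal.sum_mem _ fun t _ => ?_
  rw [map_smul, smul_eq_mul, exteriorPower.basis_repr_apply,
    exteriorPower.ιMultiDual_apply_ιMulti]
  refine Ideal.mul_mem_right _ _ (Ideal.subset_span ⟨_,
    (Set.powersetCard.ofFinEmbEquiv.symm t).injective, ?_⟩)
  rfl

namespace KoszulStrand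

section

variable {R M : Type*} [CommRing R] [AddCommGroup M] [Module R M] {n : ℕ}

/-- Left multiplication in the exterior algebra by the members of a family of vectors. -/
abbrev wedge (v : Fin n → M) (i : Fin n) : ExteriorAlgebra R M →ₗ[R] ExteriorAlgebra R M :=
  LinearMap.mulLeft R (ExteriorAlgebra.ι R (v i))

/-- Contraction in the exterior algebra by the members of a family of linear forms. -/
abbrev contract (β : Fin n → Module.Dual R M) (i : Fin n) :
    ExteriorAlgebra R M →ₗ[R] ExteriorAlgebra R M :=
  CliffordAlgebra.contractLeft (Q := (0 : QuadraticForm R M)) (β i)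

theorem wedge_wedge_self (v : Fin n → M) (i : Fin n) (u : ExteriorAlgebra R M) :
    wedge v i (wedge v i u) = 0 := by
  simp [wedge, ← mul_assoc]

theorem wedge_wedge_comm (v : Fin n → M) (i j : Fin n) (u : ExteriorAlgebra R M) :
    wedge v i (wedge v j u) = - wedge v j (wedge v i u) := by
  simp only [wedge, LinearMap.mulLeft_apply, ← mul_assoc]
  rw [eq_neg_iff_add_eq_zero, ← add_mul, ExteriorAlgebra.ι_add_mul_swap, zero_mul]

theorem contract_wedge {v : Fin n → M} {β : Fin n → Module.Dual R M} {x : R}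
    (hβ : ∀ i j, β i (v j) = if i = j then x else 0) (i j : Fin n) (u : ExteriorAlgebra R M) :
    contract β i (wedge v j u) + wedge v j (contract β i u) = if i = j then x • u else 0 := by
  have := CliffordAlgebra.contractLeft_ι_mul (Q := (0 : QuadraticForm R M)) (β i) (v j) u
  rw [hβ, ite_smul, zero_smul] at this
  exact eq_sub_iff_add_eq.1 this

/-- The family of coefficients, indexed by exponents, of a constant polynomial. -/
abbrev constTerm (u : ExteriorAlgebra R M) : (Fin n → ℕ) → ExteriorAlgebra R M :=
  Pi.single (M := fun _ => ExteriorAlgebra R M) 0 u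

/-- The differential `ω ↦ ∑ i, X i * v i ∧ ω`, augmented by `1 ↦ v 0 ∧ ⋯ ∧ v (n - 1)`. -/
def augDiff (v : Fin n → M) :
    ((Fin n → ℕ) → ExteriorAlgebra R M) × R →ₗ[R] ((Fin n → ℕ) → ExteriorAlgebra R M) × R :=
  LinearMap.inl R _ R ∘ₗ (diff (wedge v)).coprod
    (LinearMap.toSpanSingleton R _ (constTerm (ExteriorAlgebra.ιMulti R n v)))

theorem augDiff_apply (v : Fin n → M) (y : ((Fin n → ℕ) → ExteriorAlgebra R M) × R) :
    augDiff v y = (diff (wedge v) y.1 + y.2 • constTerm (ExteriorAlgebra.ιMulti R n v), 0) := by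
  simp [augDiff]

theorem augDiff_augDiff (v : Fin n → M) (y : ((Fin n → ℕ) → ExteriorAlgebra R M) × R) :
    augDiff v (augDiff v y) = 0 := by
  have h : diff (wedge v) (constTerm (ExteriorAlgebra.ιMulti R n v)) = 0 := by
    rw [diff_apply]
    refine Finset.sum_eq_zero fun i _ => ?_
    have : (wedge v i).compLeft (Fin n → ℕ) (constTerm (ExteriorAlgebra.ιMulti R n v)) = 0 := by
      ext α
      rcases eq_or_ne α 0 with rfl | hα
      · have := (ExteriorAlgebra.ιMulti R (n + 1) (M := M)).map_eq_zero_of_eq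
          (Fin.cons (v i) v : Fin (n + 1) → M) (i := 0) (j := i.succ) (by simp)
            (Fin.succ_ne_zero i).symm
        rw [ExteriorAlgebra.ιMulti_succ_apply] at this
        simpa [Matrix.vecTail, Function.comp_def] using this
      · simp [hα]
    rw [this, map_zero]
  simp only [augDiff_apply, map_add, map_smul, h,
    diff_diff (wedge_wedge_self v) (wedge_wedge_comm v)]
  simp

variable (R M n) in
/-- The terms of the strand `R → ⋀^n M → ⋀^(n+1) M ⊗ S₁ → ⋀^(n+2) M ⊗ S₂ → ⋯` of the Koszul
complex over a polynomial ring in `n` variables, preceded by zero. -/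
def augStrand : ℕ → Submodule R (((Fin n → ℕ) → ExteriorAlgebra R M) × R)
  | 0 => ⊥
  | 1 => Submodule.prod ⊥ ⊤
  | k + 2 => (homog (fun p => ⋀[R]^p M) (Fin n) (n + k) k).prod ⊥

theorem single_mem_homog {u : ExteriorAlgebra R M} (hu : u ∈ ⋀[R]^n M) :
    constTerm u ∈ homog (fun p => ⋀[R]^p M) (Fin n) (n + 0) 0 := by
  intro α
  rcases eq_or_ne α 0 with rfl | hα
  · simpa using hu
  · simp [hα]

theorem ιMulti_mem_exteriorPower (v : Fin n → M) : ExteriorAlgebra.ιMulti R n v ∈ ⋀[R]^n M :=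
  (exteriorPower.ιMulti R n v).2

theorem augDiff_mem (v : Fin n → M) (k : ℕ) (y) (hy : y ∈ augStrand R M n k) :
    augDiff v y ∈ augStrand R M n (k + 1) := by
  rw [augDiff_apply]
  match k with
  | 0 =>
    obtain rfl : y = 0 := hy
    simp only [Prod.fst_zero, Prod.snd_zero, map_zero, zero_smul, add_zero]
    exact zero_mem (augStrand R M n 1)
  | 1 =>
    have h1 : y.1 = 0 := hy.1
    refine ⟨?_, rfl⟩
    simp only [h1, map_zero, zero_add]
    exact Submodule.smul_mem _ _ (single_mem_homog (ιMulti_mem_exteriorPower v))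
  | k + 2 =>
    have h2 : y.2 = 0 := hy.2
    refine ⟨?_, rfl⟩
    simp only [h2, zero_smul, add_zero]
    exact diff_mem (fun i p => ExteriorAlgebra.ι_mul_mem_exteriorPower (v i) p) hy.1

theorem free_augStrand [Module.Free R M] (k : ℕ) : Module.Free R (augStrand R M n k) := by
  match k with
  | 0 => exact inferInstanceAs (Module.Free R (⊥ : Submodule R _))
  | 1 =>
    let e : R ≃ₗ[R] augStrand R M n 1 :=
      { toFun := fun c => ⟨(0, c), rfl, trivial⟩
        map_add' := fun c c' => by ext <;> simp
        map_smul' := fun c c' => by ext <;> simp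
        invFun := fun y => y.1.2
        left_inv := fun c => rfl
        right_inv := fun y => Subtype.ext (Prod.ext (Eq.symm y.2.1) rfl) }
    exact Module.Free.of_equiv e
  | k + 2 =>
    have := free_homog (σ := Fin n) (k := k) (gr := fun p => ⋀[R]^p M) (p := n + k)
      (inferInstanceAs (Module.Free R (⋀[R]^(n + k) M)))
    let e : homog (fun p => ⋀[R]^p M) (Fin n) (n + k) k ≃ₗ[R] augStrand R M n (k + 2) :=
      { toFun := fun ω => ⟨(ω.1, 0), ω.2, rfl⟩
        map_add' := fun c c' => by ext <;> simp
        map_smul' := fun c c' => by ext <;> simp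
        invFun := fun y => ⟨y.1.1, y.2.1⟩
        left_inv := fun c => rfl
        right_inv := fun y => Subtype.ext (Prod.ext rfl (Eq.symm y.2.2)) }
    exact Module.Free.of_equiv e

theorem pow_smul_mem_range_augDiff {v : Fin n → M} {β : Fin n → Module.Dual R M} {x : R}
    (hβ : ∀ i j, β i (v j) = if i = j then x else 0) (k : ℕ) (y)
    (hy : y ∈ augStrand R M n (k + 1)) (h : augDiff v y = 0) :
    ∃ z ∈ augStrand R M n k, augDiff v z = x ^ n • y := by
  have hprod : ExteriorAlgebra.ιMulti R n v =
      ((List.finRange n).map fun j => ExteriorAlgebra.ι R (v j)).prod := by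
    rw [ExteriorAlgebra.ιMulti_apply, List.ofFn_eq_map]
  rw [augDiff_apply, Prod.mk_eq_zero] at h
  obtain ⟨ω, c⟩ := y
  replace h := h.1
  match k with
  | 0 =>
    obtain rfl : ω = 0 := hy.1
    refine ⟨0, zero_mem _, ?_⟩
    have h0 := congrFun h 0
    simp only [map_zero, zero_add, Pi.smul_apply, Pi.single_eq_same, Pi.zero_apply, hprod] at h0
    have := ExteriorAlgebra.pow_mul_eq_zero_of_smul_prod hβ (List.nodup_finRange n) h0
    rw [List.length_finRange] at this
    simp [this, ← Prod.zero_eq_mk]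
  | 1 =>
    obtain rfl : c = 0 := hy.2
    have hω : ω ∈ homog (fun p => ⋀[R]^p M) (Fin n) (n + 0) 0 := hy.1
    have h0 (i : Fin n) : ExteriorAlgebra.ι R (v i) * ω 0 = 0 := by
      have := congrFun h (Pi.single i 1)
      rw [zero_smul, add_zero, diff_apply, Finset.sum_apply, Finset.sum_eq_single i] at this
      · simpa [mulVar] using this
      · intro j _ hj
        simp [mulVar, hj]
      · simp
    obtain ⟨w, hw, hwu⟩ := ExteriorAlgebra.exists_pow_smul_eq_prod_mul hβ (List.nodup_finRange n)
      (q := 0) (u := ω 0) (by simpa using (hω 0).1) h0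
    rw [ExteriorAlgebra.exteriorPower, pow_zero, Submodule.mem_one] at hw
    obtain ⟨b, rfl⟩ := hw
    refine ⟨(0, b), ⟨rfl, trivial⟩, ?_⟩
    rw [augDiff_apply]
    refine Prod.ext ?_ (by simp)
    ext α
    rcases eq_or_ne α 0 with rfl | hα
    · rw [List.length_finRange, ← hprod, ← Algebra.commutes, ← Algebra.smul_def] at hwu
      simp [hwu]
    · have : ω α = 0 := (hω α).2 fun h' => hα (funext fun i =>
        (Finset.sum_eq_zero_iff.1 h') i (Finset.mem_univ i))
      simp [hα, this]
  | k + 2 =>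
    obtain rfl : c = 0 := hy.2
    have hω : ω ∈ homog (fun p => ⋀[R]^p M) (Fin n) ((n + k) + 1) (k + 1) := hy.1
    rw [zero_smul, add_zero] at h
    obtain ⟨η, hη, hηω⟩ := pow_smul_mem_range_diff
      (fun i p => ExteriorAlgebra.ι_mul_mem_exteriorPower (v i) p)
      (wedge_wedge_self v) (wedge_wedge_comm v)
      (fun i p => ExteriorAlgebra.contractLeft_mem_exteriorPower (β i) p)
      (contract_wedge hβ) hω h
    refine ⟨(η, 0), ⟨hη, rfl⟩, ?_⟩
    rw [augDiff_apply]
    simp [hηω]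

theorem exists_dual_apply_ιMulti_eq [Nontrivial R] [Module.Free R M] [Module.Finite R M]
    {v : Fin n → M} {s : ℕ} (hrank : Module.finrank R M ≤ n + s + 1) {rs : List R}
    (hlen : rs.length = s + 2) (hrs : IsWeaklyRegular R rs)
    (hkill : ∀ x ∈ rs, ∃ β : Fin n → Module.Dual R M, ∀ i j, β i (v j) = if i = j then x else 0)
    {r : R} (hr : ∃ β : Fin n → Module.Dual R M, ∀ i j, β i (v j) = if i = j then r else 0) :
    ∃ f : ⋀[R]^n M →ₗ[R] R, f (exteriorPower.ιMulti R n v) = r := by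
  have hfree := free_augStrand (R := R) (M := M) (n := n)
  let d (k : ℕ) : augStrand R M n k →ₗ[R] augStrand R M n (k + 1) :=
    (augDiff v).restrict (augDiff_mem v k)
  have hd (k : ℕ) (a) : d (k + 1) (d k a) = 0 := Subtype.ext (augDiff_augDiff v a.1)
  have hsub : Subsingleton (augStrand R M n 0) :=
    inferInstanceAs (Subsingleton (⊥ : Submodule R _))
  have hexact := exact_of_isWeaklyRegular_of_pow_smul rs (fun k => augStrand R M n k) d hd
    (fun k => isWeaklyRegular_of_flat hrs) (fun x hx => by
      obtain ⟨β, hβ⟩ := hkill x hx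
      refine ⟨n, fun k a ha => ?_⟩
      obtain ⟨z, hz, hza⟩ := pow_smul_mem_range_augDiff hβ k a.1 a.2 (congrArg Subtype.val ha)
      exact ⟨⟨z, hz⟩, Subtype.ext hza⟩)
  rw [hlen] at hexact
  obtain ⟨β, hβ⟩ := hr
  obtain ⟨h, hh⟩ := exists_homotopy (fun k => augStrand R M n k) d hd (s + 2) hexact r
    (by
      rintro ⟨⟨ω, c⟩, hy⟩
      obtain rfl : c = 0 := hy.2
      have hω : ω ∈ homog (fun p => ⋀[R]^p M) (Fin n) ((n + s) + 1) (s + 1) := hy.1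
      obtain ⟨η, hη, hηω⟩ := smul_mem_range_diff_of_top
        (fun i p => ExteriorAlgebra.ι_mul_mem_exteriorPower (v i) p)
        (fun i p => ExteriorAlgebra.contractLeft_mem_exteriorPower (β i) p)
        (contract_wedge hβ) (ExteriorAlgebra.exteriorPower_eq_bot (by omega)) hω
      refine ⟨⟨(η, 0), hη, rfl⟩, Subtype.ext ?_⟩
      change augDiff v (η, 0) = _
      rw [augDiff_apply]
      simp [hηω]) 1 (by omega)
  let g : ⋀[R]^n M →ₗ[R] augStrand R M n 2 :=
    { toFun := fun u => ⟨(constTerm u.1, 0), single_mem_homog u.2, rfl⟩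
      map_add' := fun u w => Subtype.ext (Prod.ext (by simp [Pi.single_add]) (by simp))
      map_smul' := fun c u => Subtype.ext (Prod.ext (by simp [Pi.single_smul]) (by simp)) }
  let one : augStrand R M n 1 := ⟨(0, 1), rfl, trivial⟩
  have hone : d 1 one = g (exteriorPower.ιMulti R n v) := by
    refine Subtype.ext ?_
    change augDiff v (0, 1) = _
    rw [augDiff_apply]
    simp [g]
  refine ⟨LinearMap.snd R _ R ∘ₗ (augStrand R M n 1).subtype ∘ₗ h ∘ₗ g, ?_⟩
  have hz : d 1 (h (d 1 one) - r • one) = 0 := by rw [map_sub, hh, map_smul, sub_self]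
  obtain ⟨b, hb⟩ := hexact 0 (by omega) _ hz
  rw [Subsingleton.elim b 0, map_zero, eq_comm, sub_eq_zero, hone] at hb
  simp [hb, one]

end

end KoszulStrand

/-- An element killing the cokernel of a matrix whose ideal of maximal minors has, up to radical, the
maximal possible grade, at least two, is a combination of maximal minors. -/
theorem mem_span_minors_of_isWeaklyRegular {R ι : Type*} [CommRing R] [Nontrivial R] [Fintype ι]
    {n s : ℕ} (ψ : Matrix (Fin n) ι R) (hcard : Fintype.card ι ≤ n + s + 1) {rs : List R}
    (hlen : rs.length = s + 2) (hrs : IsWeaklyRegular R rs)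
    (hkill : ∀ x ∈ rs, ∃ B : Matrix ι (Fin n) R, ψ * B = Matrix.scalar (Fin n) x)
    {r : R} (hr : ∃ B : Matrix ι (Fin n) R, ψ * B = Matrix.scalar (Fin n) r) :
    r ∈ Ideal.span {x : R | ∃ c : Fin n → ι,
      Function.Injective c ∧ x = Matrix.det (Matrix.of fun i k => ψ i (c k))} := by
  have dual {x : R} (h : ∃ B : Matrix ι (Fin n) R, ψ * B = Matrix.scalar (Fin n) x) :
      ∃ β : Fin n → Module.Dual R (ι → R),
        ∀ i j, β i (fun l => ψ j l) = if i = j then x else 0 := by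
    classical
    obtain ⟨B, hB⟩ := h
    refine ⟨fun i => Fintype.linearCombination R (fun l => B l i), fun i j => ?_⟩
    have := congrFun (congrFun hB j) i
    rw [Matrix.mul_apply, Matrix.scalar_apply, Matrix.diagonal_apply] at this
    simpa [Fintype.linearCombination_apply, eq_comm] using this
  obtain ⟨f, hf⟩ := KoszulStrand.exists_dual_apply_ιMulti_eq (v := fun i l => ψ i l)
    (by rwa [Module.finrank_pi]) hlen hrs (fun x hx => dual (hkill x hx)) (dual hr)
  rw [← hf]
  exact exteriorPower.apply_ιMulti_mem_span_minors _ f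

namespace Matrix

/-- One half of McCoy's theorem. -/
theorem exists_mulVec_eq_zero_of_mul_minors_eq_zero {S m : Type*} [CommRing S] {p : ℕ}
    (A : Matrix m (Fin p) S) {r : S} (hr : r ≠ 0)
    (h : ∀ c : Fin p → m, r * (A.submatrix c id).det = 0) : ∃ v, v ≠ 0 ∧ A *ᵥ v = 0 := by
  induction p with
  | zero => exact absurd (by simpa using h Fin.elim0) hr
  | succ p ih =>
    by_cases h' : ∀ c : Fin p → m, r * (A.submatrix c Fin.succ).det = 0
    · obtain ⟨v, hv, hAv⟩ := ih (A.submatrix id Fin.succ) h'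
      refine ⟨Fin.cons 0 v, fun h0 => hv (funext fun i => congrFun h0 i.succ), ?_⟩
      ext k
      simpa [mulVec, dotProduct, Fin.sum_univ_succ] using congrFun hAv k
    · push Not at h'
      obtain ⟨c, hc⟩ := h'
      refine ⟨fun j => (-1) ^ (j : ℕ) * r * (A.submatrix c j.succAbove).det,
        fun h0 => hc (by simpa using congrFun h0 0), ?_⟩
      ext k
      rw [Pi.zero_apply, ← h (Fin.cons k c), det_succ_row_zero, mulVec, dotProduct,
        Finset.mul_sum]
      refine Finset.sum_congr rfl fun j _ => ?_
      simp only [submatrix_apply, Fin.cons_zero, id, submatrix_submatrix, Function.comp_def,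
        Fin.cons_succ]
      ring

theorem mul_eq_scalar_comm {R : Type*} [CommRing R] {m : Type*} [Fintype m] [DecidableEq m]
    {M B : Matrix m m R} (hM : M.det ∈ nonZeroDivisors R) {r : R} (h : M * B = scalar m r) :
    B * M = scalar m r := by
  have h1 : M.det • B = r • M.adjugate := by
    rw [← one_mul B, ← smul_mul_assoc, ← adjugate_mul, mul_assoc, h, scalar_apply,
      ← smul_one_eq_diagonal, mul_smul_comm, mul_one]
  have h2 : M.det • (B * M) = M.det • scalar m r := by
    rw [← smul_mul_assoc, h1, smul_mul_assoc, adjugate_mul, smul_comm, scalar_apply,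
      smul_one_eq_diagonal]
  ext i j
  exact (mul_cancel_left_mem_nonZeroDivisors hM).1 (congrFun (congrFun h2 i) j)

theorem mul_minor_mem_span_det {R : Type*} [CommRing R] {p : ℕ}
    {M B : Matrix (Fin (p + 1)) (Fin (p + 1)) R} {r : R} (h : B * M = scalar (Fin (p + 1)) r)
    (c : Fin p → Fin (p + 1)) :
    r * (M.submatrix c Fin.succ).det ∈ Ideal.span {M.det} := by
  let T : Matrix (Fin (p + 1)) (Fin (p + 1)) R :=
    of (Fin.cons (B 0) fun i => Pi.single (c i) 1)
  have hT : (T * M).det = r * (M.submatrix c Fin.succ).det := by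
    have h0 (j) : (T * M) 0 j = if j = 0 then r else 0 := by
      have := congrFun (congrFun h 0) j
      rw [scalar_apply, diagonal_apply] at this
      simpa [T, mul_apply, eq_comm] using this
    have h1 : (T * M).submatrix Fin.succ Fin.succ = M.submatrix c Fin.succ := by
      ext i j
      simp [T, mul_apply, Pi.single_apply]
    rw [det_succ_row_zero, Finset.sum_eq_single 0 (fun j _ hj => by simp [h0, hj]) (by simp)]
    simp [h0, Fin.succAbove_zero, h1]
  rw [← hT, det_mul]
  exact Ideal.mem_span_singleton.2 (Dvd.intro_left _ rfl)

theorem mem_span_det_of_mul_eq_scalar {R : Type*} [CommRing R] {p : ℕ}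
    {M B : Matrix (Fin (p + 1)) (Fin (p + 1)) R} (hM : M.det ∈ nonZeroDivisors R)
    (hker : ∀ v w, M.submatrix id Fin.succ *ᵥ v = M.det • w → ∃ v', v = M.det • v')
    {r : R} (h : M * B = scalar (Fin (p + 1)) r) : r ∈ Ideal.span {M.det} := by
  by_contra hr
  let q := Ideal.Quotient.mk (Ideal.span {M.det})
  obtain ⟨v, hv, hMv⟩ := exists_mulVec_eq_zero_of_mul_minors_eq_zero
    ((M.submatrix id Fin.succ).map q) (r := q r) (mt Ideal.Quotient.eq_zero_iff_mem.1 hr)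
    (fun c => by
      rw [submatrix_map, ← RingHom.mapMatrix_apply, ← RingHom.map_det, ← map_mul]
      exact Ideal.Quotient.eq_zero_iff_mem.2
        (mul_minor_mem_span_det (mul_eq_scalar_comm hM h) c))
  choose u hu using fun i => Ideal.Quotient.mk_surjective (v i)
  obtain rfl : q ∘ u = v := funext hu
  have hdvd (i) : ∃ w, (M.submatrix id Fin.succ *ᵥ u) i = M.det * w := by
    rw [← dvd_def, ← Ideal.mem_span_singleton, ← Ideal.Quotient.eq_zero_iff_mem]
    exact (RingHom.map_mulVec q _ _ _).trans (congrFun hMv i)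
  choose w hw using hdvd
  obtain ⟨v', rfl⟩ := hker u w (funext hw)
  refine hv (funext fun i => Ideal.Quotient.eq_zero_iff_mem.2 ?_)
  exact Ideal.mem_span_singleton.2 (Dvd.intro _ rfl)

end Matrix

section Presentation

variable {R ι κ : Type*} [CommRing R] [Fintype ι] [Fintype κ] [DecidableEq ι]
  {a : Ideal R} {π : (ι → R) →ₗ[R] R}

theorem exists_mul_eq_scalar_of_mem_colon {ψ : Matrix ι κ R}
    (hψ : ∀ w, π w ∈ a ↔ ∃ b, ψ.mulVec b = w) {r : R}
    (hr : r ∈ a.colon (LinearMap.range π : Set R)) :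
    ∃ B : Matrix κ ι R, ψ * B = Matrix.scalar ι r := by
  have (i : ι) : ∃ b, ψ.mulVec b = Pi.single i r := by
    rw [← hψ, ← mul_one r, ← smul_eq_mul, Pi.single_smul, map_smul]
    exact Submodule.mem_colon.1 hr _ ⟨_, rfl⟩
  choose b hb using this
  refine ⟨Matrix.of fun k i => b i k, ?_⟩
  ext i j
  simpa [Matrix.mul_apply, Matrix.mulVec, dotProduct, Matrix.diagonal_apply, Pi.single_apply]
    using congrFun (hb j) i

omit [Fintype κ] in
theorem det_submatrix_mem_colon {ψ : Matrix ι κ R} (hψ : ∀ k, π (fun i => ψ i k) ∈ a)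
    (c : ι → κ) : (Matrix.of fun i k => ψ i (c k)).det ∈ a.colon (LinearMap.range π : Set R) := by
  rw [Submodule.mem_colon]
  rintro _ ⟨w, rfl⟩
  set N := Matrix.of fun i k => ψ i (c k)
  have : N.det • w = ∑ k, N.adjugate.mulVec w k • fun i => ψ i (c k) := by
    rw [← Matrix.one_mulVec w, ← Matrix.smul_mulVec, ← Matrix.mul_adjugate,
      ← Matrix.mulVec_mulVec, Matrix.one_mulVec]
    ext i
    simp [Matrix.mulVec, dotProduct, N, mul_comm]
  rw [← map_smul, this, map_sum]
  exact Submodule.sum_mem _ fun k _ => by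
    rw [map_smul]
    exact Submodule.smul_mem _ _ (hψ _)

theorem eq_zero_of_mul_eq_scalar_of_card_eq [DecidableEq κ] {P : Matrix ι κ R}
    (hP : Function.Injective P.mulVec) (hcard : Fintype.card ι = Fintype.card κ + 1)
    {B : Matrix κ ι R} {r : R} (h : P * B = Matrix.scalar ι r) : r = 0 := by
  have h' : B * P = Matrix.scalar κ r := by
    refine Matrix.ext_of_mulVec_single fun j => hP ?_
    rw [Matrix.mulVec_mulVec, Matrix.mulVec_mulVec, ← Matrix.mul_assoc, h]
    congr 1
    simp [Matrix.scalar_apply, ← Matrix.smul_one_eq_diagonal]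
  have := Matrix.trace_mul_comm P B
  rw [h, h', Matrix.scalar_apply, Matrix.scalar_apply, Matrix.trace_diagonal,
    Matrix.trace_diagonal] at this
  simpa [hcard, add_mul] using this

end Presentation

theorem mem_span_minors_of_mem_colon {R : Type*} [CommRing R] [Nontrivial R] {p s : ℕ}
    {φ : (Fin p → R) →ₗ[R] (Fin (p + 1) → R)} (hφ : Function.Injective φ)
    {π : (Fin (p + 1) → R) →ₗ[R] R} (hexact : Function.Exact φ π)
    {a : Ideal R} {ψ : Matrix (Fin (p + 1)) (Fin p ⊕ Fin s) R}
    (hψ : ∀ w, π w ∈ a ↔ ∃ b, ψ.mulVec b = w)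
    (hψφ : ∀ j, (fun i => ψ i (Sum.inl j)) = φ (Pi.single j 1))
    {rs : List R} (hlen : rs.length = s)
    (hmem : ∀ x ∈ rs, x ∈ a.colon (LinearMap.range π : Set R))
    (hrs : IsWeaklyRegular R rs) {r : R} (hr : r ∈ a.colon (LinearMap.range π : Set R)) :
    r ∈ Ideal.span {x : R | ∃ c : Fin (p + 1) → Fin p ⊕ Fin s,
      Function.Injective c ∧ x = Matrix.det (Matrix.of fun i k => ψ i (c k))} := by
  have hφψ (v : Fin p → R) : φ v = (ψ.submatrix id Sum.inl).mulVec v := by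
    rw [← LinearMap.toMatrix'_mulVec]
    congr 1
    ext i j
    exact (LinearMap.toMatrix'_apply φ i j).trans (congrFun (hψφ j) i).symm
  obtain ⟨B, hB⟩ := exists_mul_eq_scalar_of_mem_colon hψ hr
  match s with
  | 0 =>
    have h0 : ψ.submatrix id Sum.inl * B.submatrix Sum.inl id = Matrix.scalar (Fin (p + 1)) r := by
      rw [← hB]
      ext i j
      simp [Matrix.mul_apply]
    rw [eq_zero_of_mul_eq_scalar_of_card_eq (fun v w h => hφ (by simpa [hφψ] using h))
      (by simp) h0]
    exact zero_mem _
  | 1 =>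
    obtain ⟨x, rfl⟩ := List.length_eq_one_iff.1 hlen
    let c : Fin (p + 1) → Fin p ⊕ Fin 1 := Fin.cons (Sum.inr 0) Sum.inl
    have hc : Function.Injective c :=
      Fin.cons_injective_iff.2 ⟨by simp, Sum.inl_injective⟩
    let e : Fin (p + 1) ≃ Fin p ⊕ Fin 1 :=
      Equiv.ofBijective c ((Fintype.bijective_iff_injective_and_card c).2 ⟨hc, by simp⟩)
    have hmul {C : Matrix (Fin p ⊕ Fin 1) (Fin (p + 1)) R} {y : R}
        (h : ψ * C = Matrix.scalar (Fin (p + 1)) y) :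
        ψ.submatrix id c * C.submatrix c id = Matrix.scalar (Fin (p + 1)) y :=
      (Matrix.submatrix_mul_equiv ψ C id e id).trans h
    obtain ⟨C, hC⟩ := exists_mul_eq_scalar_of_mem_colon hψ (hmem x (by simp))
    have hx : x ∈ nonZeroDivisors R :=
      mem_nonZeroDivisors_iff_right.2 fun z hz =>
        ((isWeaklyRegular_singleton_iff R x).1 hrs).right_eq_zero_of_smul
          (by rwa [smul_eq_mul, mul_comm])
    have hdet : (ψ.submatrix id c).det ∈ nonZeroDivisors R := by
      have := congrArg Matrix.det (hmul hC)
      rw [Matrix.det_mul, Matrix.scalar_apply, Matrix.det_diagonal, Finset.prod_const] at this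
      exact (mul_mem_nonZeroDivisors.1 (this ▸ pow_mem hx _)).1
    refine Ideal.span_mono ?_ (Matrix.mem_span_det_of_mul_eq_scalar hdet ?_ (hmul hB))
    · rintro _ rfl
      exact ⟨c, hc, rfl⟩
    · intro v w hvw
      replace hvw : φ v = (ψ.submatrix id c).det • w := by rw [hφψ]; exact hvw
      have hw : π w = 0 := by
        refine (mul_cancel_left_mem_nonZeroDivisors hdet).1 ?_
        rw [mul_zero, ← smul_eq_mul, ← map_smul, ← hvw, hexact.apply_apply_eq_zero]
      obtain ⟨v', rfl⟩ := (hexact w).1 hw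
      exact ⟨v', hφ (by rw [hvw, map_smul])⟩
  | s + 2 =>
    exact mem_span_minors_of_isWeaklyRegular ψ (by simp; omega) hlen hrs
      (fun x hx => exists_mul_eq_scalar_of_mem_colon hψ (hmem x hx)) ⟨B, hB⟩

theorem stmt18 (R : Type) [CommRing R] [IsNoetherianRing R] [IsLocalRing R]
    (I : Ideal R) (b0 : ℕ)
    (hb0 : HasBetti R (ModuleCat.of R I) 0 b0)
    (hb1 : HasBetti R (ModuleCat.of R I) 1 (b0 - 1))
    (φ : (Fin (b0-1) → R) →ₗ[R] (Fin b0 → R)) (hφ : Function.Injective φ)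
    (π : (Fin b0 → R) →ₗ[R] R) (hπ : LinearMap.range π = I)
    (hexact : Function.Exact φ π)
    (s : ℕ) (a : Ideal R) (f : Fin s → R) (ha : a = Ideal.span (Set.range f))
    (haI : a ≤ I) (J : Ideal R) (hJ : J = Submodule.colon a I)
    (hgradeJ : GradeGE R J s)
    (lam : Fin s → (Fin b0 → R)) (hlam : ∀ j, π (lam j) = f j)
    (ψ : Matrix (Fin b0) ((Fin (b0-1)) ⊕ (Fin s)) R)
    (hψ1 : ∀ j, (fun i => ψ i (Sum.inl j)) = φ (Pi.single j 1))
    (hψ2 : ∀ j, (fun i => ψ i (Sum.inr j)) = lam j) :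
    J = Ideal.span { x : R | ∃ c : Fin b0 → ((Fin (b0-1)) ⊕ (Fin s)),
      Function.Injective c ∧
      x = Matrix.det (Matrix.of fun i k => ψ i (c k)) } := by
  subst hπ ha hJ
  have hmulVec (b) : ψ.mulVec b =
      φ (fun j => b (Sum.inl j)) + ∑ j, b (Sum.inr j) • lam j := by
    have hφψ : LinearMap.toMatrix' φ = ψ.submatrix id Sum.inl := by
      ext i j
      exact (LinearMap.toMatrix'_apply φ i j).trans (congrFun (hψ1 j) i).symm
    rw [← LinearMap.toMatrix'_mulVec, hφψ]
    simp_rw [← hψ2]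
    ext i
    simp [Matrix.mulVec, dotProduct, mul_comm]
  have hψ (w) : π w ∈ Ideal.span (Set.range f) ↔ ∃ b, ψ.mulVec b = w := by
    rw [Ideal.mem_span_range_iff_exists_fun]
    constructor
    · rintro ⟨t, ht⟩
      obtain ⟨v, hv⟩ := (hexact (w - ∑ j, t j • lam j)).1 (by simp [hlam, ht])
      exact ⟨Sum.elim v t, by simp [hmulVec, hv]⟩
    · rintro ⟨b, rfl⟩
      exact ⟨fun j => b (Sum.inr j), by simp [hmulVec, hlam, hexact.apply_apply_eq_zero]⟩
  obtain ⟨rs, hlen, hmem, hrs⟩ := hgradeJ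
  refine le_antisymm (fun r hr => ?_) (Ideal.span_le.2 ?_)
  · match b0 with
    | 0 =>
      have h1 : (1 : R) ∈ Ideal.span { x : R | ∃ c : Fin 0 → Fin 0 ⊕ Fin s,
          Function.Injective c ∧ x = Matrix.det (Matrix.of fun i k => ψ i (c k)) } :=
        Ideal.subset_span ⟨Fin.elim0, Function.injective_of_subsingleton _, by simp⟩
      simpa using Ideal.mul_mem_left _ r h1
    | p + 1 =>
      exact mem_span_minors_of_mem_colon (p := p) hφ hexact hψ hψ1 hlen hmem
        hrs.toIsWeaklyRegular hr
  · rintro _ ⟨c, -, rfl⟩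
    refine det_submatrix_mem_colon (fun k => (hψ _).2 ⟨Pi.single k 1, ?_⟩) c
    ext i
    simp
end
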